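/- arXiv:0712.2290 — 10 statements merged into one kernel-verified Lean document; each statement's English description precedes it below -/
import Mathlib

section
/- There exists a nonzero constant k ∈ ℂ such that for all complex numbers x, y with 2ε²x + 1 ≠ 0, one has (2ε²x + 1)⁶ · f( −(x − ε)/(2ε²x + 1), −3y/(2ε²x + 1)² ) = k · f(x, y); in particular the order-two transformation (x,y) ↦ (−(x−ε)/(2ε²x+1), −3y/(2ε²x+1)²) preserves the curve f = 0. -/
/-- The polynomial `f(x,y) = 4y³ − (24x³ + 3)y + (8x⁶ + 20x³ − 1)` whose zero set is the
four-cuspidal trigonal curve `B̄ ⊂ Σ₂`. -/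
noncomputable def f (x y : ℂ) : ℂ :=
  4 * y ^ 3 - (24 * x ^ 3 + 3) * y + (8 * x ^ 6 + 20 * x ^ 3 - 1)

/-- `ε = (−1 + i√3)/2`, a primitive cubic root of unity. -/
noncomputable def ε : ℂ := (-1 + Complex.I * Real.sqrt 3) / 2

theorem epsilon_cube : ε ^ 3 = 1 := by
  have h : ((Real.sqrt 3 : ℝ) : ℂ) ^ 2 = 3 := by
    rw [← Complex.ofReal_pow, Real.sq_sqrt (by norm_num)]
    norm_num
  have hI : Complex.I ^ 2 = -1 := Complex.I_sq
  have hq : ε ^ 2 + ε + 1 = 0 := by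
    unfold ε
    linear_combination (1 / 4) * Complex.I ^ 2 * h + (3 / 4) * hI
  linear_combination (ε - 1) * hq

/-- In the coordinate `t = ε²x`, the symmetry becomes `t ↦ (1 - t) / (2t + 1)`. -/
theorem f_symmetry_of_rotated (t y : ℂ) (ht : 2 * t + 1 ≠ 0) :
    (2 * t + 1) ^ 6 * f ((1 - t) / (2 * t + 1)) (-3 * y / (2 * t + 1) ^ 2) = -27 * f t y := by
  unfold f
  field_simp
  ring

theorem f_eq_of_cube_eq {x x' : ℂ} (h : x ^ 3 = x' ^ 3) (y : ℂ) : f x y = f x' y := by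
  unfold f
  linear_combination (-24 * y + 8 * (x ^ 3 + x' ^ 3) + 20) * h

/-- The order-two transformation `(x,y) ↦ (−(x−ε)/(2ε²x+1), −3y/(2ε²x+1)²)` preserves the
curve `f = 0`: there is a nonzero constant `k` with
`(2ε²x + 1)⁶ · f(−(x−ε)/(2ε²x+1), −3y/(2ε²x+1)²) = k · f(x,y)`. -/
theorem order_two_symmetry :
    ∃ k : ℂ, k ≠ 0 ∧ ∀ x y : ℂ, 2 * ε ^ 2 * x + 1 ≠ 0 →
      (2 * ε ^ 2 * x + 1) ^ 6 *
          f (-(x - ε) / (2 * ε ^ 2 * x + 1)) (-3 * y / (2 * ε ^ 2 * x + 1) ^ 2) =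
        k * f x y := by
  refine ⟨-27, by norm_num, fun x y hx => ?_⟩
  have hε := epsilon_cube
  have hd : 2 * (ε ^ 2 * x) + 1 = 2 * ε ^ 2 * x + 1 := by ring
  have hrot := f_symmetry_of_rotated (ε ^ 2 * x) y (by rwa [hd])
  rw [hd] at hrot
  have hx3 : (ε ^ 2 * x) ^ 3 = x ^ 3 := by
    linear_combination x ^ 3 * (ε ^ 3 + 1) * hε
  have hmul : -(x - ε) = ε * (1 - ε ^ 2 * x) := by linear_combination x * hε
  have hcube : (-(x - ε) / (2 * ε ^ 2 * x + 1)) ^ 3 =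
      ((1 - ε ^ 2 * x) / (2 * ε ^ 2 * x + 1)) ^ 3 := by
    rw [hmul, div_pow, div_pow, mul_pow, hε, one_mul]
  rw [f_eq_of_cube_eq hcube, hrot, f_eq_of_cube_eq hx3]
end

section
/- For complex numbers a, b, c, the following three conditions are equivalent: (i) all six numbers a, b, c, a′, b′, c′ are real; (ii) there exists a real number c₀ with a = −2c₀, b = −2c₀ and c = c₀ (i.e., the section y = ax² + bx + c has the form y = −c₀(2x² + 2x − 1)); (iii) a, b, c are real and a·r₊² + b·r₊ + c = 0 and a·r₋² + b·r₋ + c = 0. -/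
/-- `r₊ = (−1+√3)/2`, one of the two real roots of `2x² + 2x − 1`. -/
noncomputable def rp : ℝ := (-1 + Real.sqrt 3) / 2

/-- `r₋ = (−1−√3)/2`, the other real root of `2x² + 2x − 1`. -/
noncomputable def rm : ℝ := (-1 - Real.sqrt 3) / 2

theorem ε_im : ε.im = √3 / 2 := by
  simp [ε]

theorem ε_sq_im : (ε ^ 2).im = -(√3 / 2) := by
  simp [ε, sq]
  ring

/-- The imaginary part of a real linear combination of `1`, `ε` and `ε²`. -/
theorem im_add_mul_ε_add_mul_ε_sq (x y z : ℝ) :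
    ((x : ℂ) + y * ε + z * ε ^ 2).im = √3 / 2 * (y - z) := by
  simp only [Complex.add_im, Complex.ofReal_im, Complex.im_ofReal_mul, ε_im, ε_sq_im]
  ring

/-- For real `x, y, z`, the transformed coefficients are real iff `x = y = -2z`. -/
theorem transformed_im_eq_zero_iff (x y z : ℝ) :
    ((((x : ℂ) - 2 * ε ^ 2 * y + 4 * ε * z) / 3).im = 0 ∧
        ((-2 * ε * (x : ℂ) + y + 4 * ε ^ 2 * z) / 3).im = 0 ∧
        ((ε ^ 2 * (x : ℂ) + ε * y + z) / 3).im = 0) ↔ x = -2 * z ∧ y = -2 * z := by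
  have h₁ := im_add_mul_ε_add_mul_ε_sq (x / 3) (4 * z / 3) (-2 * y / 3)
  have h₂ := im_add_mul_ε_add_mul_ε_sq (y / 3) (-2 * x / 3) (4 * z / 3)
  have h₃ := im_add_mul_ε_add_mul_ε_sq (z / 3) (y / 3) (x / 3)
  have hs : √3 / 2 ≠ 0 := by positivity
  push_cast at h₁ h₂ h₃
  rw [show ((x : ℂ) - 2 * ε ^ 2 * y + 4 * ε * z) / 3 =
      x / 3 + 4 * z / 3 * ε + -2 * y / 3 * ε ^ 2 by ring, h₁,
    show (-2 * ε * (x : ℂ) + y + 4 * ε ^ 2 * z) / 3 =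
      y / 3 + -2 * x / 3 * ε + 4 * z / 3 * ε ^ 2 by ring, h₂,
    show (ε ^ 2 * (x : ℂ) + ε * y + z) / 3 = z / 3 + y / 3 * ε + x / 3 * ε ^ 2 by ring, h₃]
  simp only [mul_eq_zero, hs, false_or]
  constructor
  · rintro ⟨h₁, h₂, -⟩
    constructor <;> linarith
  · rintro ⟨rfl, rfl⟩
    refine ⟨?_, ?_, ?_⟩ <;> ring

/-- A real quadratic vanishes at both `r₊` and `r₋` iff it is proportional to `2x² + 2x - 1`. -/
theorem eval_rp_rm_eq_zero_iff (x y z : ℝ) :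
    (x * rp ^ 2 + y * rp + z = 0 ∧ x * rm ^ 2 + y * rm + z = 0) ↔
      x = -2 * z ∧ y = -2 * z := by
  have hs : √3 ^ 2 = 3 := Real.sq_sqrt (by norm_num)
  have hs0 : √3 ≠ 0 := by positivity
  unfold rp rm
  constructor
  · rintro ⟨hp, hm⟩
    have hxy : y = x := by
      apply mul_left_cancel₀ hs0
      linear_combination hp - hm
    subst hxy
    have : y = -2 * z := by linear_combination hp + hm - y / 2 * hs
    exact ⟨this, this⟩
  · rintro ⟨rfl, rfl⟩
    constructor <;> linear_combination -z / 2 * hs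

/-- A section `y = ax² + bx + c` is real with respect to both real structures `conj` and
`conj′` (i.e. all six coefficients `a, b, c, a′, b′, c′` are real) if and only if it has the
form `y = −c₀(2x² + 2x − 1)` for some real `c₀`, if and only if `a`, `b`, `c` are real and
`s(r₊) = s(r₋) = 0`. -/
theorem real_sections (a b c : ℂ) :
    (((a - 2 * ε ^ 2 * b + 4 * ε * c) / 3).im = 0 ∧
        ((-2 * ε * a + b + 4 * ε ^ 2 * c) / 3).im = 0 ∧
        ((ε ^ 2 * a + ε * b + c) / 3).im = 0 ∧
        a.im = 0 ∧ b.im = 0 ∧ c.im = 0 ↔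
      ∃ c₀ : ℝ, a = -2 * (c₀ : ℂ) ∧ b = -2 * (c₀ : ℂ) ∧ c = (c₀ : ℂ)) ∧
    ((∃ c₀ : ℝ, a = -2 * (c₀ : ℂ) ∧ b = -2 * (c₀ : ℂ) ∧ c = (c₀ : ℂ)) ↔
      a.im = 0 ∧ b.im = 0 ∧ c.im = 0 ∧
        a * (rp : ℂ) ^ 2 + b * (rp : ℂ) + c = 0 ∧
        a * (rm : ℂ) ^ 2 + b * (rm : ℂ) + c = 0) := by
  have proportional_iff (x y z : ℝ) :
      (∃ c₀ : ℝ, (x : ℂ) = -2 * (c₀ : ℂ) ∧ (y : ℂ) = -2 * (c₀ : ℂ) ∧ (z : ℂ) = (c₀ : ℂ)) ↔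
        x = -2 * z ∧ y = -2 * z := by
    constructor
    · rintro ⟨c₀, hx, hy, hz⟩
      norm_cast at hx hy hz
      subst hz
      exact ⟨by exact_mod_cast hx, by exact_mod_cast hy⟩
    · rintro ⟨rfl, rfl⟩
      exact ⟨z, by push_cast; rfl, by push_cast; rfl, rfl⟩
  by_cases hreal : a.im = 0 ∧ b.im = 0 ∧ c.im = 0
  · obtain ⟨ha, hb, hc⟩ := hreal
    lift a to ℝ using ha
    lift b to ℝ using hb
    lift c to ℝ using hc
    rw [proportional_iff]
    constructor
    · simpa using transformed_im_eq_zero_iff a b c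
    · simp only [Complex.ofReal_im, true_and]
      exact_mod_cast (eval_rp_rm_eq_zero_iff a b c).symm
  · have hne : ¬∃ c₀ : ℝ, a = -2 * (c₀ : ℂ) ∧ b = -2 * (c₀ : ℂ) ∧ c = (c₀ : ℂ) := by
      rintro ⟨c₀, rfl, rfl, rfl⟩
      simp at hreal
    exact ⟨iff_of_false (fun h => hreal h.2.2.2) hne,
      iff_of_false hne fun h => hreal ⟨h.1, h.2.1, h.2.2.1⟩⟩
end

section
/- For every complex number t with t³ ≠ 1, setting a = t(t³−4)/(2(t³−1)), b = 3t²/(t³−1), c = −(t³+2)/(2(t³−1)) (the coefficients of the section inflection tangent to the curve at the point of parameter t), one has (a·r₊² + b·r₊ + c)·(a·r₋² + b·r₋ + c) = (t² − 2t − 2)⁴ / (16(t³ − 1)²). -/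
/-- For the section `y = ax² + bx + c` inflection tangent to the curve at the point of
parameter `t` one has `s(r₊)·s(r₋) = (t² − 2t − 2)⁴ / (16(t³ − 1)²)`. -/
theorem inflection_tangent_product (t : ℂ) (h : t ^ 3 ≠ 1) :
    let a : ℂ := t * (t ^ 3 - 4) / (2 * (t ^ 3 - 1))
    let b : ℂ := 3 * t ^ 2 / (t ^ 3 - 1)
    let c : ℂ := -(t ^ 3 + 2) / (2 * (t ^ 3 - 1))
    (a * (rp : ℂ) ^ 2 + b * (rp : ℂ) + c) * (a * (rm : ℂ) ^ 2 + b * (rm : ℂ) + c) =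
      (t ^ 2 - 2 * t - 2) ^ 4 / (16 * (t ^ 3 - 1) ^ 2) := by
  intro a b c
  have hD : t ^ 3 - 1 ≠ 0 := sub_ne_zero.mpr h
  have hsum : (rp : ℂ) + (rm : ℂ) = -1 := by
    simp only [rp, rm]
    push_cast
    ring
  have hsqrt : ((Real.sqrt 3 : ℝ) : ℂ) ^ 2 = 3 := by
    rw [← Complex.ofReal_pow, Real.sq_sqrt (by norm_num)]
    norm_num
  have hprod : (rp : ℂ) * (rm : ℂ) = -1 / 2 := by
    simp only [rp, rm]
    push_cast
    linear_combination (-1 / 4 : ℂ) * hsqrt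
  have hvieta : (a * (rp : ℂ) ^ 2 + b * (rp : ℂ) + c) * (a * (rm : ℂ) ^ 2 + b * (rm : ℂ) + c) =
      a ^ 2 / 4 + a * b / 2 + 2 * a * c - b ^ 2 / 2 - b * c + c ^ 2 := by
    linear_combination
      (a ^ 2 * ((rp : ℂ) * rm - 1 / 2) + a * b * ((rp : ℂ) + rm) - 2 * a * c + b ^ 2) * hprod +
        (-a * b / 2 + a * c * ((rp : ℂ) + rm - 1) + b * c) * hsum
  rw [hvieta]
  simp only [a, b, c]
  field_simp
  ring
end

section
/- In the polynomial ring ℝ[x], the cube (x − r₊)³ divides f(x, (√3/3)(2x² + 2x − 1)) and the cube (x − r₋)³ divides f(x, −(√3/3)(2x² + 2x − 1)); that is, the two sections y = ±√3(2x² + 2x − 1)/3 are inflection tangent to the curve f = 0 at the points (r₊, 0) and (r₋, 0), respectively. -/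
open Polynomial

/-- The restriction of `f(x,y) = 4y³ − (24x³+3)y + (8x⁶+20x³−1)` to the section
`y = √3(2x² + 2x − 1)/3`, as a polynomial in `x`. -/
noncomputable def fPlus : Polynomial ℝ :=
  4 * (C (Real.sqrt 3 / 3) * (2 * X ^ 2 + 2 * X - 1)) ^ 3 -
    (24 * X ^ 3 + 3) * (C (Real.sqrt 3 / 3) * (2 * X ^ 2 + 2 * X - 1)) +
    (8 * X ^ 6 + 20 * X ^ 3 - 1)

/-- The restriction of `f(x,y)` to the section `y = −√3(2x² + 2x − 1)/3`. -/
noncomputable def fMinus : Polynomial ℝ :=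
  4 * (-(C (Real.sqrt 3 / 3)) * (2 * X ^ 2 + 2 * X - 1)) ^ 3 -
    (24 * X ^ 3 + 3) * (-(C (Real.sqrt 3 / 3)) * (2 * X ^ 2 + 2 * X - 1)) +
    (8 * X ^ 6 + 20 * X ^ 3 - 1)

/-- For either square root `s` of `3`, the section `y = s(2x² + 2x − 1)/3` meets the curve
to order at least three over `x = (−1+s)/2`. -/
theorem cube_dvd_section_of_sq_eq_three {s : ℝ} (hs : s ^ 2 = 3) :
    (X - C ((-1 + s) / 2)) ^ 3 ∣
      4 * (C (s / 3) * (2 * X ^ 2 + 2 * X - 1)) ^ 3 -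
        (24 * X ^ 3 + 3) * (C (s / 3) * (2 * X ^ 2 + 2 * X - 1)) +
        (8 * X ^ 6 + 20 * X ^ 3 - 1 : ℝ[X]) := by
  refine ⟨C (8 + 32 / 9 * s) * X ^ 3 + C (4 + 4 / 3 * s) * X ^ 2 - C (8 + 16 / 3 * s) * X +
    C (4 / 9 * s), Polynomial.funext fun x => ?_⟩
  simp only [eval_add, eval_sub, eval_mul, eval_pow, eval_X, eval_C, eval_ofNat, eval_one]
  grind

/-- The sections `y = ±√3(2x² + 2x − 1)/3` are inflection tangent to the curve `f = 0` at
the points `(r₊, 0)` and `(r₋, 0)`: the cubes `(x − r₊)³` and `(x − r₋)³` divide the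
corresponding restrictions of `f`. -/
theorem inflection_tangent_sections :
    (X - C rp) ^ 3 ∣ fPlus ∧ (X - C rm) ^ 3 ∣ fMinus := by
  have hs : Real.sqrt 3 ^ 2 = 3 := Real.sq_sqrt (by norm_num)
  refine ⟨cube_dvd_section_of_sq_eq_three hs, ?_⟩
  have h := cube_dvd_section_of_sq_eq_three (s := -Real.sqrt 3) (by rwa [neg_sq])
  rwa [neg_div, C_neg, ← sub_eq_add_neg] at h
end

section
/- For each m ∈ {1, 2}, the assignment α ↦ σ₁, ᾱ ↦ σ₁, β ↦ σ₁, γ ↦ σ₂, γ̄ ↦ σ₂ induces group isomorphisms G_m/⟪αβ⁻¹⟫ ≅ G_m/⟪αβ⁻¹, ᾱβ⁻¹⟫ ≅ B₃/⟪(σ₁σ₂σ₁)²⟫, and likewise for m = 0 the assignment α, β ↦ σ₁, γ ↦ σ₂ induces an isomorphism G₀/⟪αβ⁻¹⟫ ≅ B₃/⟪(σ₁σ₂σ₁)²⟫; moreover B₃/⟪(σ₁σ₂σ₁)²⟫ is isomorphic to the free product (ℤ/2) * (ℤ/3). Here ⟪·⟫ denotes the normal closure of the listed elements. -/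
namespace Sextics

/-! Generators of the free group on five letters: `0 ↦ α`, `1 ↦ ᾱ`, `2 ↦ β`, `3 ↦ γ`,
`4 ↦ γ̄`. -/

abbrev F5 := FreeGroup (Fin 5)

def fa : F5 := FreeGroup.of 0
def fa' : F5 := FreeGroup.of 1
def fb : F5 := FreeGroup.of 2
def fc : F5 := FreeGroup.of 3
def fc' : F5 := FreeGroup.of 4

/-- Relators of the group `G̃`: the braid relations `αβα = βαβ`, `ᾱβᾱ = βᾱβ`,
`γβγ = βγβ`, `γ̄βγ̄ = βγ̄β` and the relation at infinity `βγαβγ̄ᾱ = 1`. -/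
def relsT : Set F5 :=
  {fa * fb * fa * (fb * fa * fb)⁻¹, fa' * fb * fa' * (fb * fa' * fb)⁻¹,
   fc * fb * fc * (fb * fc * fb)⁻¹, fc' * fb * fc' * (fb * fc' * fb)⁻¹,
   fb * fc * fa * fb * fc' * fa'}

/-- Relators of `G₁`: those of `G̃` together with `αγα = γαγ`, `ᾱγ̄ᾱ = γ̄ᾱγ̄`,
`γαγ̄ = γ̄ᾱγ`, `γγ̄ = γ̄γ`. -/
def rels1 : Set F5 :=
  relsT ∪
    {fa * fc * fa * (fc * fa * fc)⁻¹, fa' * fc' * fa' * (fc' * fa' * fc')⁻¹,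
     fc * fa * fc' * (fc' * fa' * fc)⁻¹, fc * fc' * (fc' * fc)⁻¹}

/-- Relators of `G₂`: those of `G̃` together with `ᾱγα = αγ̄ᾱ`, `αγ̄ᾱ = γαγ̄`,
`γαγ̄ = γ̄ᾱγ`. -/
def rels2 : Set F5 :=
  relsT ∪
    {fa' * fc * fa * (fa * fc' * fa')⁻¹, fa * fc' * fa' * (fc * fa * fc')⁻¹,
     fc * fa * fc' * (fc' * fa' * fc)⁻¹}

abbrev G1 := PresentedGroup rels1
abbrev G2 := PresentedGroup rels2

def a1 : G1 := PresentedGroup.of 0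
def a1' : G1 := PresentedGroup.of 1
def b1 : G1 := PresentedGroup.of 2
def c1 : G1 := PresentedGroup.of 3
def c1' : G1 := PresentedGroup.of 4

def a2 : G2 := PresentedGroup.of 0
def a2' : G2 := PresentedGroup.of 1
def b2 : G2 := PresentedGroup.of 2
def c2 : G2 := PresentedGroup.of 3
def c2' : G2 := PresentedGroup.of 4

/-- Relators of `G₀ = ⟨α, β, γ | αβα = βαβ, βγβ = γβγ, γαγ = αγα, (αβγ)² = 1⟩`
(generators `0 ↦ α`, `1 ↦ β`, `2 ↦ γ`). -/
def rels0 : Set (FreeGroup (Fin 3)) :=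
  {FreeGroup.of 0 * FreeGroup.of 1 * FreeGroup.of 0 *
      (FreeGroup.of 1 * FreeGroup.of 0 * FreeGroup.of 1)⁻¹,
   FreeGroup.of 1 * FreeGroup.of 2 * FreeGroup.of 1 *
      (FreeGroup.of 2 * FreeGroup.of 1 * FreeGroup.of 2)⁻¹,
   FreeGroup.of 2 * FreeGroup.of 0 * FreeGroup.of 2 *
      (FreeGroup.of 0 * FreeGroup.of 2 * FreeGroup.of 0)⁻¹,
   (FreeGroup.of 0 * FreeGroup.of 1 * FreeGroup.of 2) ^ 2}

abbrev G0 := PresentedGroup rels0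

def a0 : G0 := PresentedGroup.of 0
def b0 : G0 := PresentedGroup.of 1
def c0 : G0 := PresentedGroup.of 2

/-- The braid group `B₃ = ⟨σ₁, σ₂ | σ₁σ₂σ₁ = σ₂σ₁σ₂⟩`. -/
def relsB3 : Set (FreeGroup (Fin 2)) :=
  {FreeGroup.of 0 * FreeGroup.of 1 * FreeGroup.of 0 *
      (FreeGroup.of 1 * FreeGroup.of 0 * FreeGroup.of 1)⁻¹}

abbrev B3 := PresentedGroup relsB3

def σ1 : B3 := PresentedGroup.of 0
def σ2 : B3 := PresentedGroup.of 1

/-- The quotient `B₃/⟪(σ₁σ₂σ₁)²⟫`. -/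
abbrev Q3 := B3 ⧸ Subgroup.normalClosure ({(σ1 * σ2 * σ1) ^ 2} : Set B3)

def q1 : Q3 := QuotientGroup.mk σ1
def q2 : Q3 := QuotientGroup.mk σ2

end Sextics

open Sextics

namespace Sextics

section BraidRelation

variable {G : Type*} [Group G] {b c : G}

theorem commute_braid_sq_left (h : b * c * b = c * b * c) : Commute ((b * c * b) ^ 2) b := by
  have hc : b * c * b * c = b * (b * c * b) := by
    simpa [mul_assoc] using congrArg (b * ·) h.symm
  have hb : b * c * b * b = c * (b * c * b) := by
    simpa [mul_assoc] using congrArg (· * b) h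
  rw [commute_iff_eq, pow_two, mul_assoc, hb, ← mul_assoc, hc, mul_assoc]

theorem commute_braid_sq_right (h : b * c * b = c * b * c) : Commute ((b * c * b) ^ 2) c := by
  rw [h]; exact commute_braid_sq_left h.symm

theorem sq_mul_mul_eq_braid_sq (h : b * c * b = c * b * c) :
    (b * b * c) ^ 2 = (b * c * b) ^ 2 :=
  calc (b * b * c) ^ 2 = b * (b * c * b) * (b * c) := by simp only [pow_two, mul_assoc]
    _ = b * c * b * (c * b * c) := by
      simpa [mul_assoc] using congrArg (fun t => b * t * (b * c)) h
    _ = (b * c * b) ^ 2 := by rw [← h, pow_two]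

theorem eq_one_of_braid_mul_central {z : G} (h : b * c * b = c * b * c)
    (hzb : Commute z b) (hzc : Commute z c)
    (hz : c * z * b * (c * z) = b * (c * z) * b) : z = 1 := by
  have h1 : c * z * b * (c * z) = c * b * c * (z * z) := by
    rw [mul_assoc c z b, hzb.eq, ← mul_assoc, ← mul_assoc, mul_assoc _ z c, hzc.eq]
    simp only [mul_assoc]
  have h2 : b * (c * z) * b = c * b * c * z := by
    rw [← h, ← mul_assoc, mul_assoc _ z b, hzb.eq, ← mul_assoc]
  rw [h1, h2] at hz
  simpa using mul_left_cancel hz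

/-- The relations of `G̃` and `γαγ̄ = γ̄ᾱγ` force `γ̄ = γ`, `ᾱ = β` and `(βγβ)² = 1` as soon as
`α = β`. -/
theorem collapse_of_relations {a' d : G} (hbc : b * c * b = c * b * c)
    (hbd : d * b * d = b * d * b) (hinf : b * c * b * b * d * a' = 1)
    (hcd : c * b * d = d * a' * c) : d = c ∧ a' = b ∧ (b * c * b) ^ 2 = 1 := by
  set z := (b * c * b) ^ 2 with hz
  have hzb : Commute z b := commute_braid_sq_left hbc
  have hzc : Commute z c := commute_braid_sq_right hbc
  have hda : d * a' = c * b * d * c⁻¹ := eq_mul_inv_of_mul_eq hcd.symm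
  have hzd : z * d = c := by
    rw [mul_assoc (b * c * b * b), hda] at hinf
    rw [← mul_inv_eq_one, ← hinf, hz]
    simp only [pow_two, mul_assoc]
  have hd : d = c * z⁻¹ := by
    rw [← hzc.inv_left.eq, ← hzd, inv_mul_cancel_left]
  have hz1 : z = 1 := by
    rw [hd] at hbd
    exact inv_eq_one.mp (eq_one_of_braid_mul_central hbc hzb.inv_left hzc.inv_left hbd)
  have hdc : d = c := by rw [hd, hz1, inv_one, mul_one]
  refine ⟨hdc, ?_, hz1⟩
  rw [hdc] at hcd
  exact (mul_left_cancel (mul_right_cancel hcd)).symm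

end BraidRelation

section Q3

theorem q1_q2_braid : q1 * q2 * q1 = q2 * q1 * q2 :=
  congrArg (QuotientGroup.mk (s := Subgroup.normalClosure {(σ1 * σ2 * σ1) ^ 2}))
    (PresentedGroup.mk_eq_mk_of_mul_inv_mem (rels := relsB3) (Set.mem_singleton _))

theorem q1_q2_sq : (q1 * q2 * q1) ^ 2 = 1 :=
  (QuotientGroup.eq_one_iff _).2 (Subgroup.subset_normalClosure (Set.mem_singleton _))

variable {G : Type*} [Group G]

/-- The universal property of `B₃/⟪(σ₁σ₂σ₁)²⟫`. -/
def Q3.lift (x y : G) (h : x * y * x = y * x * y) (h2 : (x * y * x) ^ 2 = 1) : Q3 →* G :=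
  QuotientGroup.lift _
    (PresentedGroup.toGroup (f := ![x, y]) (rels := relsB3) (by
      rintro r rfl
      simp [h]))
    (by
      refine (Subgroup.normalClosure_subset_iff (N := MonoidHom.ker _)).1 ?_
      rintro r rfl
      simpa [MonoidHom.mem_ker, σ1, σ2] using h2)

variable (x y : G) (h : x * y * x = y * x * y) (h2 : (x * y * x) ^ 2 = 1)

@[simp]
theorem Q3.lift_q1 : Q3.lift x y h h2 q1 = x := 
  (QuotientGroup.lift_mk ..).trans (PresentedGroup.toGroup.of _)

@[simp]
theorem Q3.lift_q2 : Q3.lift x y h h2 q2 = y := 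
  (QuotientGroup.lift_mk ..).trans (PresentedGroup.toGroup.of _)

theorem Q3.hom_ext {f g : Q3 →* G} (h1 : f q1 = g q1) (h2 : f q2 = g q2) : f = g := by
  refine QuotientGroup.monoidHom_ext _ (PresentedGroup.ext fun i => ?_)
  fin_cases i
  exacts [h1, h2]

end Q3

theorem exists_quotient_equiv_Q3 {ι : Type*} {rels : Set (FreeGroup ι)}
    {S : Set (PresentedGroup rels)} (φ : ι → Q3) (hφ : ∀ r ∈ rels, FreeGroup.lift φ r = 1)
    (hS : ∀ s ∈ S, PresentedGroup.toGroup hφ s = 1)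
    (ψ : Q3 →* PresentedGroup rels ⧸ Subgroup.normalClosure S)
    (hψ : ∀ i, ψ (φ i) = QuotientGroup.mk (PresentedGroup.of i))
    {i j : ι} (hi : φ i = q1) (hj : φ j = q2) :
    ∃ e : (PresentedGroup rels ⧸ Subgroup.normalClosure S) ≃* Q3,
      ∀ k, e (QuotientGroup.mk (PresentedGroup.of k)) = φ k := by
  let θ : (PresentedGroup rels ⧸ Subgroup.normalClosure S) →* Q3 :=
    QuotientGroup.lift _ (PresentedGroup.toGroup hφ)
      ((Subgroup.normalClosure_subset_iff (N := MonoidHom.ker _)).1 hS)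
  have hθ (k) : θ (QuotientGroup.mk (PresentedGroup.of k)) = φ k := by
    simp [θ]
  refine ⟨MonoidHom.toMulEquiv θ ψ ?_ ?_, hθ⟩
  · refine QuotientGroup.monoidHom_ext _ (PresentedGroup.ext fun k => ?_)
    simp [hθ, hψ]
  · refine Q3.hom_ext ?_ ?_
    · rw [← hi]; simp [hθ, hψ]
    · rw [← hj]; simp [hθ, hψ]

theorem exists_quotient_equiv_Q3_five {rels : Set F5} {S : Set (PresentedGroup rels)}
    (hrels : relsT ⊆ rels) (hrel : fc * fa * fc' * (fc' * fa' * fc)⁻¹ ∈ rels)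
    (hφ : ∀ r ∈ rels, FreeGroup.lift ![q1, q1, q1, q2, q2] r = 1)
    (hab : PresentedGroup.of 0 * (PresentedGroup.of 2)⁻¹ ∈ S)
    (hS : ∀ s ∈ S, PresentedGroup.toGroup hφ s = 1) :
    ∃ e : (PresentedGroup rels ⧸ Subgroup.normalClosure S) ≃* Q3,
      ∀ k, e (QuotientGroup.mk (PresentedGroup.of k)) = ![q1, q1, q1, q2, q2] k := by
  let π : F5 →* PresentedGroup rels ⧸ Subgroup.normalClosure S :=
    (QuotientGroup.mk' _).comp (PresentedGroup.mk rels)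
  have hπ {r : F5} (hr : r ∈ rels) : π r = 1 := by
    simp [π, PresentedGroup.one_of_mem hr]
  have hπ' {r s : F5} (hr : r * s⁻¹ ∈ rels) : π r = π s := by
    rw [← mul_inv_eq_one, ← map_inv, ← map_mul, hπ hr]
  have h0 : π fa = π fb := by
    rw [← mul_inv_eq_one]
    exact (QuotientGroup.eq_one_iff _).2 (Subgroup.subset_normalClosure hab)
  have hbc : π fb * π fc * π fb = π fc * π fb * π fc := by
    simpa using (hπ' (r := fc * fb * fc) (s := fb * fc * fb) (hrels (by simp [relsT]))).symm
  have hbd : π fc' * π fb * π fc' = π fb * π fc' * π fb := by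
    simpa using hπ' (r := fc' * fb * fc') (s := fb * fc' * fb) (hrels (by simp [relsT]))
  have hinf : π fb * π fc * π fb * π fb * π fc' * π fa' = 1 := by
    simpa [h0] using hπ (r := fb * fc * fa * fb * fc' * fa') (hrels (by simp [relsT]))
  have hcd : π fc * π fb * π fc' = π fc' * π fa' * π fc := by
    simpa [h0] using hπ' hrel
  obtain ⟨hd, ha, hsq⟩ := collapse_of_relations hbc hbd hinf hcd
  refine exists_quotient_equiv_Q3 _ hφ hS (Q3.lift (π fb) (π fc) hbc hsq) (fun k => ?_)
    (i := 2) (j := 3) rfl rfl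
  fin_cases k
  · exact (Q3.lift_q1 ..).trans h0.symm
  · exact (Q3.lift_q1 ..).trans ha.symm
  · exact Q3.lift_q1 ..
  · exact Q3.lift_q2 ..
  · exact (Q3.lift_q2 ..).trans hd.symm

theorem q2_q1_alternating_eq_one : q2 * q1 * q2 * q1 * q2 * q1 = 1 :=
  calc q2 * q1 * q2 * q1 * q2 * q1 = q2 * q1 * q2 * (q1 * q2 * q1) := by simp only [mul_assoc]
    _ = 1 := by rw [← q1_q2_braid, ← pow_two, q1_q2_sq]

theorem lift_rels1 : ∀ r ∈ rels1, FreeGroup.lift ![q1, q1, q1, q2, q2] r = 1 := by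
  have h := q1_q2_braid
  rintro r ((rfl | rfl | rfl | rfl | rfl) | (rfl | rfl | rfl | rfl)) <;>
    simp [fa, fa', fb, fc, fc', h, -mul_inv_rev, q2_q1_alternating_eq_one]

theorem lift_rels2 : ∀ r ∈ rels2, FreeGroup.lift ![q1, q1, q1, q2, q2] r = 1 := by
  have h := q1_q2_braid
  rintro r ((rfl | rfl | rfl | rfl | rfl) | (rfl | rfl | rfl)) <;>
    simp [fa, fa', fb, fc, fc', h, -mul_inv_rev, q2_q1_alternating_eq_one]

theorem lift_rels0 : ∀ r ∈ rels0, FreeGroup.lift ![q1, q1, q2] r = 1 := by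
  have h := q1_q2_braid
  have h2 : (q1 * q1 * q2) ^ 2 = 1 := by
    rw [sq_mul_mul_eq_braid_sq h, q1_q2_sq]
  rintro r (rfl | rfl | rfl | rfl) <;>
    simp [h, -mul_inv_rev, h2]

theorem exists_quotient_equiv_Q3_three :
    ∃ e : (G0 ⧸ Subgroup.normalClosure ({a0 * b0⁻¹} : Set G0)) ≃* Q3,
      ∀ k, e (QuotientGroup.mk (PresentedGroup.of k)) = ![q1, q1, q2] k := by
  let p : G0 →* G0 ⧸ Subgroup.normalClosure ({a0 * b0⁻¹} : Set G0) := QuotientGroup.mk' _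
  have hab : p a0 = p b0 := by
    rw [← mul_inv_eq_one]
    exact (QuotientGroup.eq_one_iff _).2 (Subgroup.subset_normalClosure rfl)
  have hbc : p b0 * p c0 * p b0 = p c0 * p b0 * p c0 :=
    congrArg p (PresentedGroup.mk_eq_mk_of_mul_inv_mem (rels := rels0) (Or.inr (Or.inl rfl)))
  have habc : (p a0 * p b0 * p c0) ^ 2 = 1 :=
    congrArg p (PresentedGroup.one_of_mem (rels := rels0) (Or.inr (Or.inr (Or.inr rfl))))
  have hsq : (p b0 * p c0 * p b0) ^ 2 = 1 := by
    rw [← sq_mul_mul_eq_braid_sq hbc, ← habc, hab]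
  refine exists_quotient_equiv_Q3 _ lift_rels0 ?_ (Q3.lift (p b0) (p c0) hbc hsq) (fun k => ?_)
    (i := 1) (j := 2) rfl rfl
  · rintro s rfl
    simp [a0, b0]
  · fin_cases k
    · exact (Q3.lift_q1 ..).trans hab.symm
    · exact Q3.lift_q1 ..
    · exact Q3.lift_q2 ..

section FreeProduct

variable {G : Type*} [Group G]

/-- The homomorphism from the cyclic group of order `n` sending the generator to `g`. -/
def zmodPowersHom (n : ℕ) (g : G) (hg : g ^ n = 1) : Multiplicative (ZMod n) →* G :=
  AddMonoidHom.toMultiplicativeLeft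
    (ZMod.lift n ⟨zmultiplesHom (Additive G) (Additive.ofMul g), by
      simpa using congrArg Additive.ofMul hg⟩)

@[simp]
theorem zmodPowersHom_ofAdd_one (n : ℕ) (g : G) (hg : g ^ n = 1) :
    zmodPowersHom n g hg (Multiplicative.ofAdd 1) = g := by
  have := ZMod.lift_coe n ⟨zmultiplesHom (Additive G) (Additive.ofMul g), by
      simpa using congrArg Additive.ofMul hg⟩ 1
  simpa [zmodPowersHom] using congrArg Additive.toMul this

theorem zmod_hom_ext {n : ℕ} {f g : Multiplicative (ZMod n) →* G}
    (h : f (Multiplicative.ofAdd 1) = g (Multiplicative.ofAdd 1)) : f = g := by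
  refine MonoidHom.ext fun x => ?_
  obtain ⟨k, hk⟩ := ZMod.intCast_surjective x.toAdd
  have : x = Multiplicative.ofAdd (1 : ZMod n) ^ k := by
    rw [← ofAdd_zsmul, zsmul_one, hk, ofAdd_toAdd]
  rw [this, map_zpow, map_zpow, h]

theorem ofAdd_one_pow (n : ℕ) : Multiplicative.ofAdd (1 : ZMod n) ^ n = 1 := by
  rw [← ofAdd_nsmul]; simp

theorem nonempty_Q3_equiv_coprod :
    Nonempty (Q3 ≃* Monoid.Coprod (Multiplicative (ZMod 2)) (Multiplicative (ZMod 3))) := by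
  let x : Monoid.Coprod (Multiplicative (ZMod 2)) (Multiplicative (ZMod 3)) :=
    Monoid.Coprod.inl (Multiplicative.ofAdd 1)
  let y : Monoid.Coprod (Multiplicative (ZMod 2)) (Multiplicative (ZMod 3)) :=
    Monoid.Coprod.inr (Multiplicative.ofAdd 1)
  have hx : x ^ 2 = 1 := by rw [← map_pow, ofAdd_one_pow, map_one]
  have hy : y ^ 3 = 1 := by rw [← map_pow, ofAdd_one_pow, map_one]
  have hxyx : y⁻¹ * x * (x⁻¹ * y ^ 2) * (y⁻¹ * x) = x := by group
  have hyxy : x⁻¹ * y ^ 2 * (y⁻¹ * x) * (x⁻¹ * y ^ 2) = x :=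
    calc _ = x⁻¹ * y ^ 3 := by group
      _ = x := by rw [hy, mul_one, inv_eq_iff_mul_eq_one, ← pow_two, hx]
  have hq : (q1 * q2) ^ 3 = 1 :=
    calc (q1 * q2) ^ 3 = q1 * q2 * q1 * (q2 * q1 * q2) := by
          simp only [pow_succ, pow_zero, one_mul, mul_assoc]
      _ = 1 := by rw [← q1_q2_braid, ← pow_two, q1_q2_sq]
  let f := Q3.lift (y⁻¹ * x) (x⁻¹ * y ^ 2) (hxyx.trans hyxy.symm) (by rw [hxyx, hx])
  let g := Monoid.Coprod.lift (zmodPowersHom 2 (q1 * q2 * q1) q1_q2_sq)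
    (zmodPowersHom 3 (q1 * q2) hq)
  have hgx : g x = q1 * q2 * q1 := by simp [g, x]
  have hgy : g y = q1 * q2 := by simp [g, y]
  have hf1 : f q1 = y⁻¹ * x := Q3.lift_q1 ..
  have hf2 : f q2 = x⁻¹ * y ^ 2 := Q3.lift_q2 ..
  refine ⟨MonoidHom.toMulEquiv f g (Q3.hom_ext ?_ ?_)
    (Monoid.Coprod.hom_ext (zmod_hom_ext ?_) (zmod_hom_ext ?_))⟩
  · simp only [MonoidHom.comp_apply, hf1, map_mul, map_inv, hgx, hgy, MonoidHom.id_apply]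
    group
  · simp only [MonoidHom.comp_apply, hf2, map_mul, map_inv, pow_two, hgx, hgy,
      MonoidHom.id_apply]
    group
  · change f (g x) = x
    rw [hgx, map_mul, map_mul, hf1, hf2, hxyx]
  · change f (g y) = y
    rw [hgy, map_mul, hf1, hf2]
    group

end FreeProduct

end Sextics

/-- Lemma `A2` of the paper: for `m ∈ {1,2}` the assignment `α, ᾱ, β ↦ σ₁`, `γ, γ̄ ↦ σ₂`
induces isomorphisms `G_m/⟪αβ⁻¹⟫ ≅ G_m/⟪αβ⁻¹, ᾱβ⁻¹⟫ ≅ B₃/⟪(σ₁σ₂σ₁)²⟫`; likewise, for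
`m = 0` the assignment `α, β ↦ σ₁`, `γ ↦ σ₂` induces `G₀/⟪αβ⁻¹⟫ ≅ B₃/⟪(σ₁σ₂σ₁)²⟫`;
moreover `B₃/⟪(σ₁σ₂σ₁)²⟫ ≅ ℤ/2 ∗ ℤ/3`. -/
theorem perturbed_cusp_groups :
    (∃ e : (G1 ⧸ Subgroup.normalClosure ({a1 * b1⁻¹} : Set G1)) ≃* Q3,
        e (QuotientGroup.mk a1) = q1 ∧ e (QuotientGroup.mk a1') = q1 ∧
        e (QuotientGroup.mk b1) = q1 ∧ e (QuotientGroup.mk c1) = q2 ∧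
        e (QuotientGroup.mk c1') = q2) ∧
    (∃ e : (G1 ⧸ Subgroup.normalClosure ({a1 * b1⁻¹, a1' * b1⁻¹} : Set G1)) ≃* Q3,
        e (QuotientGroup.mk a1) = q1 ∧ e (QuotientGroup.mk a1') = q1 ∧
        e (QuotientGroup.mk b1) = q1 ∧ e (QuotientGroup.mk c1) = q2 ∧
        e (QuotientGroup.mk c1') = q2) ∧
    (∃ e : (G2 ⧸ Subgroup.normalClosure ({a2 * b2⁻¹} : Set G2)) ≃* Q3,
        e (QuotientGroup.mk a2) = q1 ∧ e (QuotientGroup.mk a2') = q1 ∧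
        e (QuotientGroup.mk b2) = q1 ∧ e (QuotientGroup.mk c2) = q2 ∧
        e (QuotientGroup.mk c2') = q2) ∧
    (∃ e : (G2 ⧸ Subgroup.normalClosure ({a2 * b2⁻¹, a2' * b2⁻¹} : Set G2)) ≃* Q3,
        e (QuotientGroup.mk a2) = q1 ∧ e (QuotientGroup.mk a2') = q1 ∧
        e (QuotientGroup.mk b2) = q1 ∧ e (QuotientGroup.mk c2) = q2 ∧
        e (QuotientGroup.mk c2') = q2) ∧
    (∃ e : (G0 ⧸ Subgroup.normalClosure ({a0 * b0⁻¹} : Set G0)) ≃* Q3,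
        e (QuotientGroup.mk a0) = q1 ∧ e (QuotientGroup.mk b0) = q1 ∧
        e (QuotientGroup.mk c0) = q2) ∧
    Nonempty (Q3 ≃* Monoid.Coprod (Multiplicative (ZMod 2)) (Multiplicative (ZMod 3))) := by
  refine ⟨?_, ?_, ?_, ?_, ?_, nonempty_Q3_equiv_coprod⟩
  · obtain ⟨e, he⟩ := exists_quotient_equiv_Q3_five (S := {a1 * b1⁻¹}) (rels := rels1)
      Set.subset_union_left (by simp [rels1]) lift_rels1 rfl
      (by rintro s rfl; simp [a1, b1])
    exact ⟨e, he 0, he 1, he 2, he 3, he 4⟩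
  · obtain ⟨e, he⟩ := exists_quotient_equiv_Q3_five (S := {a1 * b1⁻¹, a1' * b1⁻¹})
      (rels := rels1) Set.subset_union_left (by simp [rels1]) lift_rels1 (Or.inl rfl)
      (by rintro s (rfl | rfl) <;> simp [a1, a1', b1])
    exact ⟨e, he 0, he 1, he 2, he 3, he 4⟩
  · obtain ⟨e, he⟩ := exists_quotient_equiv_Q3_five (S := {a2 * b2⁻¹}) (rels := rels2)
      Set.subset_union_left (by simp [rels2]) lift_rels2 rfl
      (by rintro s rfl; simp [a2, b2])
    exact ⟨e, he 0, he 1, he 2, he 3, he 4⟩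
  · obtain ⟨e, he⟩ := exists_quotient_equiv_Q3_five (S := {a2 * b2⁻¹, a2' * b2⁻¹})
      (rels := rels2) Set.subset_union_left (by simp [rels2]) lift_rels2 (Or.inl rfl)
      (by rintro s (rfl | rfl) <;> simp [a2, a2', b2])
    exact ⟨e, he 0, he 1, he 2, he 3, he 4⟩
  · obtain ⟨e, he⟩ := exists_quotient_equiv_Q3_three
    exact ⟨e, he 0, he 1, he 2⟩
end

section
/- For each m ∈ {0, 1, 2}, the quotient of G_m by the normal closure of {αβ⁻¹, γβ⁻¹} and the quotient of G_m by the normal closure of {αβ⁻¹, γ̄β⁻¹} (for m = 0 the latter with γ in place of γ̄) are both isomorphic to the cyclic group ℤ/6. -/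
/-- Commuting elements that satisfy the braid relation are equal. -/
theorem Commute.eq_of_braid {Q : Type*} [Group Q] {x b : Q} (hc : Commute x b)
    (h : x * b * x = b * x * b) : x = b := by
  rw [hc.eq, mul_assoc, mul_assoc, hc.eq] at h
  have hmul := mul_left_cancel h
  rw [← hc.eq] at hmul
  exact mul_left_cancel hmul

/-- An element satisfying the braid relation with one of its inverse fifth roots coincides
with it. -/
theorem eq_of_braid_of_pow_five_mul_eq_one {Q : Type*} [Group Q] {x b : Q}
    (h : x * b * x = b * x * b) (h5 : b ^ 5 * x = 1) : x = b := by
  refine Commute.eq_of_braid ?_ h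
  rw [← inv_eq_of_mul_eq_one_right h5]
  exact ((Commute.refl b).pow_left 5).inv_left

namespace PresentedGroup

variable {ι : Type*} {rels : Set (FreeGroup ι)}

/-- Relators vanish in every quotient of a presented group. -/
theorem lift_mk_of_eq_one (N : Subgroup (PresentedGroup rels)) [N.Normal]
    {r : FreeGroup ι} (hr : r ∈ rels) :
    FreeGroup.lift (fun i => (QuotientGroup.mk (of i) : PresentedGroup rels ⧸ N)) r = 1 := by
  have h : FreeGroup.lift (fun i => (QuotientGroup.mk (of i) : PresentedGroup rels ⧸ N)) =
      (QuotientGroup.mk' N).comp (mk rels) := by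
    ext i
    simp [of]
  rw [h, MonoidHom.comp_apply, one_of_mem hr, map_one]

/-- A quotient of a presented group in which all generators coincide with an element of
exponent `n` is cyclic of order `n`, provided that sending every generator to `1 : ZMod n`
is compatible with the relations. -/
theorem nonempty_quotient_mulEquiv_zmod (n : ℕ) (S : Set (PresentedGroup rels)) (j : ι)
    (hgen : ∀ i, (QuotientGroup.mk (of i) : PresentedGroup rels ⧸ Subgroup.normalClosure S) =
      QuotientGroup.mk (of j))
    (hpow : (QuotientGroup.mk (of j) : PresentedGroup rels ⧸ Subgroup.normalClosure S) ^ n = 1)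
    (hrels : ∀ r ∈ rels,
      FreeGroup.lift (fun _ => Multiplicative.ofAdd (1 : ZMod n)) r = 1)
    (hS : ∀ s ∈ S, toGroup hrels s = 1) :
    Nonempty ((PresentedGroup rels ⧸ Subgroup.normalClosure S) ≃*
      Multiplicative (ZMod n)) := by
  set N := Subgroup.normalClosure S
  let t : PresentedGroup rels ⧸ N := QuotientGroup.mk (of j)
  let φ : PresentedGroup rels ⧸ N →* Multiplicative (ZMod n) :=
    QuotientGroup.lift N (toGroup hrels) (Subgroup.normalClosure_le_normal hS)
  have hφ (k : ℤ) : φ (t ^ k) = Multiplicative.ofAdd (k : ZMod n) := by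
    rw [map_zpow]
    have : φ t = Multiplicative.ofAdd 1 := toGroup.of hrels
    rw [this, ← ofAdd_zsmul, zsmul_one]
  have ht (q : PresentedGroup rels ⧸ N) : ∃ k : ℤ, t ^ k = q := by
    obtain ⟨g, rfl⟩ := QuotientGroup.mk_surjective q
    obtain ⟨w, rfl⟩ := mk_surjective rels g
    induction w using FreeGroup.induction_on with
    | C1 => exact ⟨0, by simp⟩
    | of i => exact ⟨1, by rw [zpow_one]; exact (hgen i).symm⟩
    | inv_of i ih =>
      obtain ⟨k, hk⟩ := ih
      exact ⟨-k, by rw [zpow_neg, hk]; simp⟩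
    | mul x y hx hy =>
      obtain ⟨k, hk⟩ := hx
      obtain ⟨l, hl⟩ := hy
      exact ⟨k + l, by rw [zpow_add, hk, hl]; simp⟩
  refine ⟨MulEquiv.ofBijective φ ⟨?_, ?_⟩⟩
  · rw [injective_iff_map_eq_one]
    intro q hq
    obtain ⟨k, rfl⟩ := ht q
    rw [hφ, ofAdd_eq_one, ZMod.intCast_zmod_eq_zero_iff_dvd] at hq
    obtain ⟨m, rfl⟩ := hq
    rw [zpow_mul, zpow_natCast, hpow, one_zpow]
  · intro z
    obtain ⟨k, hk⟩ := ZMod.intCast_surjective z.toAdd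
    exact ⟨t ^ k, by rw [hφ, hk, ofAdd_toAdd]⟩

end PresentedGroup

namespace Sextics

theorem lift_one_of_mem_rels0 : ∀ r ∈ rels0,
    FreeGroup.lift (fun _ => Multiplicative.ofAdd (1 : ZMod 6)) r = 1 := by
  simp only [rels0, Set.mem_insert_iff, Set.mem_singleton_iff]
  rintro r (rfl | rfl | rfl | rfl) <;>
    simp only [map_mul, map_inv, map_pow, FreeGroup.lift_apply_of] <;> decide

theorem lift_one_of_mem_rels1 : ∀ r ∈ rels1,
    FreeGroup.lift (fun _ => Multiplicative.ofAdd (1 : ZMod 6)) r = 1 := by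
  simp only [rels1, relsT, Set.mem_union, Set.mem_insert_iff, Set.mem_singleton_iff, fa, fa',
    fb, fc, fc']
  rintro r ((rfl | rfl | rfl | rfl | rfl) | (rfl | rfl | rfl | rfl)) <;>
    simp only [map_mul, map_inv, FreeGroup.lift_apply_of] <;> decide

theorem lift_one_of_mem_rels2 : ∀ r ∈ rels2,
    FreeGroup.lift (fun _ => Multiplicative.ofAdd (1 : ZMod 6)) r = 1 := by
  simp only [rels2, relsT, Set.mem_union, Set.mem_insert_iff, Set.mem_singleton_iff, fa, fa',
    fb, fc, fc']
  rintro r ((rfl | rfl | rfl | rfl | rfl) | (rfl | rfl | rfl)) <;>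
    simp only [map_mul, map_inv, FreeGroup.lift_apply_of] <;> decide

/-- The relations of `G₁` in a quotient of `G₁`. -/
theorem relations_quotient_G1 (N : Subgroup G1) [N.Normal] {a a' b c c' : G1 ⧸ N}
    (ha : a = a1) (ha' : a' = a1') (hb : b = b1) (hc : c = c1) (hc' : c' = c1') :
    a' * b * a' = b * a' * b ∧ c * b * c = b * c * b ∧ c' * b * c' = b * c' * b ∧
      b * c * a * b * c' * a' = 1 ∧ c * a * c' = c' * a' * c ∧ c * c' = c' * c := by
  subst ha ha' hb hc hc'
  have h := fun r (hr : r ∈ rels1) => PresentedGroup.lift_mk_of_eq_one N hr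
  simp only [rels1, relsT, Set.mem_union, Set.mem_insert_iff, Set.mem_singleton_iff,
    or_imp, forall_and, forall_eq, fa, fa', fb, fc, fc', map_mul, map_inv,
    mul_inv_eq_one] at h
  obtain ⟨⟨-, h1, h2, h3, h4⟩, -, -, h5, h6⟩ := h
  exact ⟨h1, h2, h3, h4, h5, h6⟩

/-- The relations of `G₂` in a quotient of `G₂`. -/
theorem relations_quotient_G2 (N : Subgroup G2) [N.Normal] {a a' b c c' : G2 ⧸ N}
    (ha : a = a2) (ha' : a' = a2') (hb : b = b2) (hc : c = c2) (hc' : c' = c2') :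
    a' * b * a' = b * a' * b ∧ c * b * c = b * c * b ∧ c' * b * c' = b * c' * b ∧
      b * c * a * b * c' * a' = 1 ∧ a' * c * a = a * c' * a' ∧ a * c' * a' = c * a * c' ∧
      c * a * c' = c' * a' * c := by
  subst ha ha' hb hc hc'
  have h := fun r (hr : r ∈ rels2) => PresentedGroup.lift_mk_of_eq_one N hr
  simp only [rels2, relsT, Set.mem_union, Set.mem_insert_iff, Set.mem_singleton_iff,
    or_imp, forall_and, forall_eq, fa, fa', fb, fc, fc', map_mul, map_inv,
    mul_inv_eq_one] at h
  obtain ⟨⟨-, h1, h2, h3, h4⟩, h5, h6, h7⟩ := h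
  exact ⟨h1, h2, h3, h4, h5, h6, h7⟩

theorem mk_eq_of_mul_inv_mem {G : Type*} [Group G] {S : Set G} {x y : G} (h : x * y⁻¹ ∈ S) :
    (x : G ⧸ Subgroup.normalClosure S) = y := by
  rw [← mul_inv_eq_one, ← QuotientGroup.mk_inv, ← QuotientGroup.mk_mul,
    QuotientGroup.eq_one_iff]
  exact Subgroup.subset_normalClosure h

theorem nonempty_quotient_G0 :
    Nonempty ((G0 ⧸ Subgroup.normalClosure ({a0 * b0⁻¹, c0 * b0⁻¹} : Set G0)) ≃*
      Multiplicative (ZMod 6)) := by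
  set S : Set G0 := {a0 * b0⁻¹, c0 * b0⁻¹} with hS
  have hab : (a0 : G0 ⧸ Subgroup.normalClosure S) = b0 := mk_eq_of_mul_inv_mem (by simp [hS])
  have hcb : (c0 : G0 ⧸ Subgroup.normalClosure S) = b0 := mk_eq_of_mul_inv_mem (by simp [hS])
  have h : ((a0 : G0 ⧸ Subgroup.normalClosure S) * b0 * c0) ^ 2 = 1 :=
    PresentedGroup.lift_mk_of_eq_one (Subgroup.normalClosure S)
      (r := (FreeGroup.of 0 * FreeGroup.of 1 * FreeGroup.of 2) ^ 2) (by simp [rels0])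
  refine PresentedGroup.nonempty_quotient_mulEquiv_zmod 6 S 1 ?_ ?_ lift_one_of_mem_rels0 ?_
  · intro i
    fin_cases i
    exacts [hab, rfl, hcb]
  · rw [hab, hcb] at h
    change (b0 : G0 ⧸ Subgroup.normalClosure S) ^ 6 = 1
    rw [← h]
    simp only [pow_succ, pow_zero, one_mul, mul_assoc]
  · rintro s (rfl | rfl) <;> simp [a0, b0, c0]

theorem nonempty_quotient_G1 {S : Set G1}
    (hS : ∀ s ∈ S, PresentedGroup.toGroup lift_one_of_mem_rels1 s = 1)
    {b : G1 ⧸ Subgroup.normalClosure S} (hb : b = b1)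
    (ha : a1 = b) (ha' : a1' = b) (hc : c1 = b) (hc' : c1' = b) (h6 : b ^ 6 = 1) :
    Nonempty ((G1 ⧸ Subgroup.normalClosure S) ≃* Multiplicative (ZMod 6)) := by
  subst hb
  refine PresentedGroup.nonempty_quotient_mulEquiv_zmod 6 S 2 ?_ h6 lift_one_of_mem_rels1 hS
  intro i
  fin_cases i
  exacts [ha, ha', rfl, hc, hc']

theorem nonempty_quotient_G2 {S : Set G2}
    (hS : ∀ s ∈ S, PresentedGroup.toGroup lift_one_of_mem_rels2 s = 1)
    {b : G2 ⧸ Subgroup.normalClosure S} (hb : b = b2)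
    (ha : a2 = b) (ha' : a2' = b) (hc : c2 = b) (hc' : c2' = b) (h6 : b ^ 6 = 1) :
    Nonempty ((G2 ⧸ Subgroup.normalClosure S) ≃* Multiplicative (ZMod 6)) := by
  subst hb
  refine PresentedGroup.nonempty_quotient_mulEquiv_zmod 6 S 2 ?_ h6 lift_one_of_mem_rels2 hS
  intro i
  fin_cases i
  exacts [ha, ha', rfl, hc, hc']

section CommonRelations

variable {Q : Type*} [Group Q] {x y b : Q}

/-- The quotient of `G₁` by `α = β = γ`, with `x = ᾱ`, `y = γ̄`. -/
theorem eq_of_relations_G1_gamma (hy : y * b * y = b * y * b)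
    (h : b * b * b * b * y * x = 1) (h' : b * b * y = y * x * b) :
    x = b ∧ y = b ∧ b ^ 6 = 1 := by
  have h5 : b ^ 5 * y = 1 := by
    apply mul_left_cancel (a := b)
    calc b * (b ^ 5 * y) = b ^ 4 * (b * b * y) := by group
      _ = b * b * b * b * y * x * b := by rw [h']; simp only [pow_succ, pow_zero, one_mul, mul_assoc]
      _ = b * 1 := by rw [h, one_mul, mul_one]
  obtain rfl := eq_of_braid_of_pow_five_mul_eq_one hy h5
  refine ⟨?_, rfl, by rwa [← pow_succ] at h5⟩
  refine (eq_inv_of_mul_eq_one_right (a := y ^ 5) ?_).trans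
    (eq_inv_of_mul_eq_one_right h5).symm
  rw [← h]
  simp only [pow_succ, pow_zero, one_mul, mul_assoc]

/-- The quotient of `G₁` by `α = β = γ̄`, with `x = ᾱ`, `y = γ`. -/
theorem eq_of_relations_G1_gamma_bar (hy : y * b * y = b * y * b)
    (h : b * y * b * b * b * x = 1) (h' : y * b * b = b * x * y) (hc : y * b = b * y) :
    x = b ∧ y = b ∧ b ^ 6 = 1 := by
  obtain rfl := Commute.eq_of_braid hc hy
  obtain rfl : y = x := mul_left_cancel (mul_right_cancel h')
  exact ⟨rfl, rfl, by rw [← h]; simp only [pow_succ, pow_zero, one_mul, mul_assoc]⟩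

/-- The quotient of `G₂` by `α = β = γ`, with `x = ᾱ`, `y = γ̄`. -/
theorem eq_of_relations_G2_gamma (hx : x * b * x = b * x * b)
    (h : b * b * b * b * y * x = 1) (h' : x * b * b = b * y * x) :
    x = b ∧ y = b ∧ b ^ 6 = 1 := by
  have h5 : b ^ 5 * x = 1 := by
    apply mul_left_cancel (a := b ^ (-2 : ℤ))
    apply mul_right_cancel (b := b ^ 2)
    calc b ^ (-2 : ℤ) * (b ^ 5 * x) * b ^ 2 = b ^ 3 * (x * b ^ 2) := by group
      _ = b ^ 3 * (x * b * b) := by rw [pow_two b, ← mul_assoc x]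
      _ = b * b * b * b * y * x := by rw [h']; simp only [pow_succ, pow_zero, one_mul, mul_assoc]
      _ = b ^ (-2 : ℤ) * 1 * b ^ 2 := by rw [h]; group
  obtain rfl := eq_of_braid_of_pow_five_mul_eq_one hx h5
  rw [← pow_succ] at h5
  refine ⟨rfl, ?_, h5⟩
  apply mul_right_cancel (b := x)
  apply mul_left_cancel (a := x ^ 4)
  calc x ^ 4 * (y * x) = x * x * x * x * y * x := by simp only [pow_succ, pow_zero, one_mul, mul_assoc]
    _ = x ^ 4 * (x * x) := by rw [h, ← h5]; simp only [pow_succ, pow_zero, one_mul, mul_assoc]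

/-- The quotient of `G₂` by `α = β = γ̄`, with `x = ᾱ`, `y = γ`. -/
theorem eq_of_relations_G2_gamma_bar (hy : y * b * y = b * y * b)
    (h : b * y * b * b * b * x = 1) (h' : b * b * x = y * b * b) :
    x = b ∧ y = b ∧ b ^ 6 = 1 := by
  have h1 : b * y * b ^ 4 = 1 := by
    calc b * y * b ^ 4 = (b * y * b) * b ^ 3 := by group
      _ = y * b * (y * b * b) * b := by rw [← hy]; simp only [pow_succ, pow_zero, one_mul, mul_assoc]
      _ = b⁻¹ * (b * y * b * b * b * x) * b := by rw [← h']; group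
      _ = 1 := by rw [h]; group
  have h5 : b ^ 5 * y = 1 := by
    calc b ^ 5 * y = b ^ 4 * (b * y * b ^ 4) * b ^ (-4 : ℤ) := by group
      _ = 1 := by rw [h1]; group
  obtain rfl := eq_of_braid_of_pow_five_mul_eq_one hy h5
  obtain rfl : x = y := mul_left_cancel (h')
  exact ⟨rfl, rfl, by rw [← h]; simp only [pow_succ, pow_zero, one_mul, mul_assoc]⟩

end CommonRelations

end Sextics

open Sextics

/-- Lemma `2A2` of the paper: for each `m ∈ {0,1,2}`, the quotient of `G_m` by the normal
closure of `{αβ⁻¹, γβ⁻¹}`, as well as the quotient by the normal closure of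
`{αβ⁻¹, γ̄β⁻¹}` (with `γ` in place of `γ̄` when `m = 0`), is isomorphic to `ℤ/6`. -/
theorem perturbed_two_cusps_groups :
    Nonempty ((G0 ⧸ Subgroup.normalClosure ({a0 * b0⁻¹, c0 * b0⁻¹} : Set G0)) ≃*
      Multiplicative (ZMod 6)) ∧
    Nonempty ((G1 ⧸ Subgroup.normalClosure ({a1 * b1⁻¹, c1 * b1⁻¹} : Set G1)) ≃*
      Multiplicative (ZMod 6)) ∧
    Nonempty ((G1 ⧸ Subgroup.normalClosure ({a1 * b1⁻¹, c1' * b1⁻¹} : Set G1)) ≃*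
      Multiplicative (ZMod 6)) ∧
    Nonempty ((G2 ⧸ Subgroup.normalClosure ({a2 * b2⁻¹, c2 * b2⁻¹} : Set G2)) ≃*
      Multiplicative (ZMod 6)) ∧
    Nonempty ((G2 ⧸ Subgroup.normalClosure ({a2 * b2⁻¹, c2' * b2⁻¹} : Set G2)) ≃*
      Multiplicative (ZMod 6)) := by
  refine ⟨nonempty_quotient_G0, ?_, ?_, ?_, ?_⟩
  · have ha := mk_eq_of_mul_inv_mem (S := {a1 * b1⁻¹, c1 * b1⁻¹}) (Or.inl rfl)
    have hc := mk_eq_of_mul_inv_mem (S := {a1 * b1⁻¹, c1 * b1⁻¹}) (Or.inr rfl)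
    obtain ⟨-, -, hy, h, h', -⟩ :=
      relations_quotient_G1 (Subgroup.normalClosure {a1 * b1⁻¹, c1 * b1⁻¹})
        ha.symm rfl rfl hc.symm rfl
    obtain ⟨hx, hy, h6⟩ := eq_of_relations_G1_gamma hy h h'
    refine nonempty_quotient_G1 ?_ rfl ha hx hc hy h6
    rintro s (rfl | rfl) <;> simp [a1, b1, c1]
  · have ha := mk_eq_of_mul_inv_mem (S := {a1 * b1⁻¹, c1' * b1⁻¹}) (Or.inl rfl)
    have hc := mk_eq_of_mul_inv_mem (S := {a1 * b1⁻¹, c1' * b1⁻¹}) (Or.inr rfl)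
    obtain ⟨-, hy, -, h, h', hcomm⟩ :=
      relations_quotient_G1 (Subgroup.normalClosure {a1 * b1⁻¹, c1' * b1⁻¹})
        ha.symm rfl rfl rfl hc.symm
    obtain ⟨hx, hy, h6⟩ := eq_of_relations_G1_gamma_bar hy h h' hcomm
    refine nonempty_quotient_G1 ?_ rfl ha hx hy hc h6
    rintro s (rfl | rfl) <;> simp [a1, b1, c1']
  · have ha := mk_eq_of_mul_inv_mem (S := {a2 * b2⁻¹, c2 * b2⁻¹}) (Or.inl rfl)
    have hc := mk_eq_of_mul_inv_mem (S := {a2 * b2⁻¹, c2 * b2⁻¹}) (Or.inr rfl)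
    obtain ⟨hx, -, -, h, h', -, -⟩ :=
      relations_quotient_G2 (Subgroup.normalClosure {a2 * b2⁻¹, c2 * b2⁻¹})
        ha.symm rfl rfl hc.symm rfl
    obtain ⟨hx, hy, h6⟩ := eq_of_relations_G2_gamma hx h h'
    refine nonempty_quotient_G2 ?_ rfl ha hx hc hy h6
    rintro s (rfl | rfl) <;> simp [a2, b2, c2]
  · have ha := mk_eq_of_mul_inv_mem (S := {a2 * b2⁻¹, c2' * b2⁻¹}) (Or.inl rfl)
    have hc := mk_eq_of_mul_inv_mem (S := {a2 * b2⁻¹, c2' * b2⁻¹}) (Or.inr rfl)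
    obtain ⟨-, hy, -, h, -, h', -⟩ :=
      relations_quotient_G2 (Subgroup.normalClosure {a2 * b2⁻¹, c2' * b2⁻¹})
        ha.symm rfl rfl rfl hc.symm
    obtain ⟨hx, hy, h6⟩ := eq_of_relations_G2_gamma_bar hy h h'
    refine nonempty_quotient_G2 ?_ rfl ha hx hy hc h6
    rintro s (rfl | rfl) <;> simp [a2, b2, c2']
end

section
/- Set β₁ = αβα⁻¹ and γ₁ = γ. The assignment α ↦ σ₁, ᾱ ↦ σ₃, β ↦ σ₂, γ ↦ σ₂⁻¹σ₃σ₂, γ̄ ↦ σ₂⁻¹σ₁σ₂ induces group isomorphisms G₂/⟪β₁γ₁β₁⁻¹γ₁⁻¹⟫ ≅ B₄/⟪σ₁²σ₂σ₃²σ₂⟫ and G₁/⟪β₁γ₁β₁⁻¹γ₁⁻¹⟫ ≅ B₄/⟪σ₁²σ₂σ₃²σ₂⟫, where ⟪·⟫ denotes the normal closure. -/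
namespace Sextics

/-- The braid group
`B₄ = ⟨σ₁, σ₂, σ₃ | σ₁σ₂σ₁ = σ₂σ₁σ₂, σ₂σ₃σ₂ = σ₃σ₂σ₃, σ₁σ₃ = σ₃σ₁⟩`. -/
def relsB4 : Set (FreeGroup (Fin 3)) :=
  {FreeGroup.of 0 * FreeGroup.of 1 * FreeGroup.of 0 *
      (FreeGroup.of 1 * FreeGroup.of 0 * FreeGroup.of 1)⁻¹,
   FreeGroup.of 1 * FreeGroup.of 2 * FreeGroup.of 1 *
      (FreeGroup.of 2 * FreeGroup.of 1 * FreeGroup.of 2)⁻¹,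
   FreeGroup.of 0 * FreeGroup.of 2 * (FreeGroup.of 2 * FreeGroup.of 0)⁻¹}

abbrev B4 := PresentedGroup relsB4

def t1 : B4 := PresentedGroup.of 0
def t2 : B4 := PresentedGroup.of 1
def t3 : B4 := PresentedGroup.of 2

/-- The quotient `B₄/⟪σ₁²σ₂σ₃²σ₂⟫`. -/
abbrev QB4 := B4 ⧸ Subgroup.normalClosure ({t1 ^ 2 * t2 * t3 ^ 2 * t2} : Set B4)

def p1 : QB4 := QuotientGroup.mk t1
def p2 : QB4 := QuotientGroup.mk t2
def p3 : QB4 := QuotientGroup.mk t3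

section Words

variable {H : Type*} [Group H]

/-- If `x, b, c` satisfy the braid relations of `B₄`, and `C` is braided with `b` and subject to
`b x c² b x b⁻¹ C = 1`, then `C = x` and the sphere relation holds. -/
lemma eq_and_sphere_of_braid {x b c C : H} (hxb : x * b * x = b * x * b) (hxc : x * c = c * x)
    (hCb : C * b * C = b * C * b) (hC : b * x * c * c * b * x * b⁻¹ * C = 1) :
    C = x ∧ c * c * b * x * x * b = 1 := by
  obtain ⟨M, hM⟩ : ∃ M, M = c * c * b * x * x * b := ⟨_, rfl⟩
  have hxM : x * M = M * x := calc
    x * M = (x * c) * c * b * x * x * b := by rw [hM]; group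
    _ = c * (x * c) * b * x * x * b := by simp only [hxc, mul_assoc]
    _ = c * c * (x * b * x) * x * b := by rw [hxc]; group
    _ = c * c * b * x * (b * x * b) := by rw [hxb]; group
    _ = M * x := by rw [← hxb, hM]; group
  have hD : C⁻¹ = b * M * b⁻¹ * x⁻¹ := calc
    C⁻¹ = b * x * c * c * b * x * b⁻¹ := (eq_inv_of_mul_eq_one_left hC).symm
    _ = b * (x * M) * (b * x * b)⁻¹ := by rw [hM]; group
    _ = b * M * b⁻¹ * x⁻¹ := by rw [hxM, ← hxb]; group
  have hCM : C = x * b * M⁻¹ * b⁻¹ := by rw [← inv_inv C, hD]; group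
  have hxM' : M⁻¹ * x = x * M⁻¹ := by
    rw [inv_mul_eq_iff_eq_mul, ← mul_assoc, eq_mul_inv_iff_mul_eq, hxM]
  have key : (x * b * x) * M⁻¹ * b * M⁻¹ * b⁻¹ = (b * x * b) * M⁻¹ := calc
    _ = x * b * (x * M⁻¹) * b * M⁻¹ * b⁻¹ := by group
    _ = C * b * C := by rw [← hxM', hCM]; group
    _ = (b * x * b) * M⁻¹ := by rw [hCb, hCM]; group
  have hM1 : M = 1 := by
    rw [hxb] at key
    have : (b * x * b * M⁻¹) * (b * M⁻¹ * b⁻¹) = (b * x * b * M⁻¹) * 1 := by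
      rw [mul_one]; simpa only [mul_assoc] using key
    have := mul_left_cancel this
    simpa using this
  exact ⟨by rw [hCM, hM1]; group, hM ▸ hM1⟩

/-- If `a, c, C` are braided with `b`, and `aba⁻¹` commutes with `c`, then the two further relations
`bc(aba⁻¹)caC = 1` and `caC = CAc` force `a, b, A` to satisfy the relations of the sphere braid
group, with `c = b⁻¹Ab` and `C = b⁻¹ab`. -/
lemma sphere_relations {a A b c C : H} (hab : a * b * a = b * a * b) (hcb : c * b * c = b * c * b)
    (hCb : C * b * C = b * C * b)
    (hcomm : (a * b * a⁻¹) * c * (a * b * a⁻¹)⁻¹ * c⁻¹ = 1)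
    (hinf : b * c * (a * b * a⁻¹) * c * a * C = 1) (hA : c * a * C = C * A * c) :
    a * A = A * a ∧ c = b⁻¹ * A * b ∧ C = b⁻¹ * a * b ∧ a ^ 2 * b * A ^ 2 * b = 1 := by
  obtain ⟨x, hx⟩ : ∃ x, x = a * b * a⁻¹ := ⟨_, rfl⟩
  have ha : a = b * x * b⁻¹ := calc
    a = (a * b * a) * a⁻¹ * b⁻¹ := by group
    _ = (b * a * b) * a⁻¹ * b⁻¹ := by rw [hab]
    _ = b * x * b⁻¹ := by rw [hx]; group
  rw [← hx] at hcomm hinf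
  have hxc : x * c = c * x := by
    rw [mul_inv_eq_one, mul_inv_eq_iff_eq_mul] at hcomm; exact hcomm
  have hxb : x * b * x = b * x * b := by
    calc x * b * x = b⁻¹ * (a * b * a) * b := by rw [ha]; group
      _ = b * x * b := by rw [hab, ha]; group
  obtain ⟨rfl, hs⟩ := eq_and_sphere_of_braid hxb hxc hCb (by
    calc b * x * c * c * b * x * b⁻¹ * C = b * (x * c) * c * (b * x * b⁻¹) * C := by group
      _ = 1 := by rw [hxc, ← ha, ← hinf]; group)
  have hc2 : C * C = b⁻¹ * c⁻¹ * c⁻¹ * b⁻¹ := by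
    have : c * c * b * (C * C) * b = 1 := by rw [← hs]; group
    calc C * C = b⁻¹ * c⁻¹ * c⁻¹ * (c * c * b * (C * C) * b) * b⁻¹ := by group
      _ = _ := by rw [this]; group
  have hA' : A = b * c * b⁻¹ := by
    have hcC : C⁻¹ * c = c * C⁻¹ := by
      rw [inv_mul_eq_iff_eq_mul, ← mul_assoc, eq_mul_inv_iff_mul_eq, hxc]
    have haC : a = C⁻¹ * b * C := by
      rw [ha, mul_inv_eq_iff_eq_mul, mul_assoc, mul_assoc, eq_inv_mul_iff_mul_eq, ← mul_assoc,
        ← mul_assoc, hxb]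
    have hcb' : c * b * c⁻¹ = b⁻¹ * c * b := by
      rw [mul_inv_eq_iff_eq_mul, mul_assoc, mul_assoc, eq_inv_mul_iff_mul_eq, ← mul_assoc,
        ← mul_assoc, ← hcb]
    calc A = C⁻¹ * (C * A * c) * c⁻¹ := by group
      _ = (C⁻¹ * c) * a * C * c⁻¹ := by rw [← hA]; group
      _ = c * (C * C)⁻¹ * b * (C * C) * c⁻¹ := by rw [hcC, haC]; group
      _ = (c * b * c) * (c * b * c⁻¹) * (c * b * c)⁻¹ := by simp [hc2, mul_assoc]
      _ = b * c * b⁻¹ := by rw [hcb', hcb]; group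
  refine ⟨?_, by rw [hA']; group, by rw [ha]; group, ?_⟩
  · calc a * A = b * (C * c) * b⁻¹ := by rw [ha, hA']; group
      _ = A * a := by rw [hxc, ha, hA']; group
  · calc a ^ 2 * b * A ^ 2 * b = b * (C * C) * b * c * c := by
          simp [ha, hA', pow_two, mul_assoc]
      _ = 1 := by rw [hc2]; group

lemma braid_conj {a b : H} (hab : a * b * a = b * a * b) : b⁻¹ * a * b = a * b * a⁻¹ := by
  rw [eq_mul_inv_iff_mul_eq, mul_assoc, mul_assoc, inv_mul_eq_iff_eq_mul, ← mul_assoc,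
    ← mul_assoc, hab]

lemma braid_conj_left {a b : H} (hab : a * b * a = b * a * b) :
    (b⁻¹ * a * b) * b * (b⁻¹ * a * b) = b * (b⁻¹ * a * b) * b := calc
  _ = b⁻¹ * (a * b * a) * b := by group
  _ = _ := by rw [hab]; group

lemma braid_conj_right {a A b : H} (hab : a * b * a = b * a * b) (hAb : A * b * A = b * A * b)
    (haA : a * A = A * a) :
    a * (b⁻¹ * A * b) * a = (b⁻¹ * A * b) * a * (b⁻¹ * A * b) := by
  have haA' : A⁻¹ * a = a * A⁻¹ := by
    rw [inv_mul_eq_iff_eq_mul, ← mul_assoc, eq_mul_inv_iff_mul_eq, haA]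
  rw [braid_conj hAb]
  calc a * (A * b * A⁻¹) * a = (a * A) * b * (A⁻¹ * a) := by group
    _ = A * (a * b * a) * A⁻¹ := by rw [haA, haA']; group
    _ = A * b * (a * A⁻¹) * A * b * A⁻¹ := by rw [hab]; group
    _ = A * b * A⁻¹ * a * (A * b * A⁻¹) := by rw [← haA']; group

/-- In the sphere braid group, `A²ba² = a²bA²`. -/
lemma sphere_swap {a A b : H} (hs : a ^ 2 * b * A ^ 2 * b = 1) :
    A ^ 2 * b * a ^ 2 = a ^ 2 * b * A ^ 2 := by
  rw [mul_eq_one_iff_eq_inv.1 hs]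
  have h : A ^ 2 * b * a ^ 2 = (a ^ 2 * b)⁻¹ * (a ^ 2 * b * A ^ 2 * b) * a ^ 2 := by group
  rw [h, hs]
  group

/-- In the sphere braid group, `Aca = aCA` for `c = b⁻¹Ab`, `C = b⁻¹ab`. -/
lemma sphere_mul_conj_mul {a A b : H} (hab : a * b * a = b * a * b)
    (hAb : A * b * A = b * A * b) (haA : a * A = A * a) (hs : a ^ 2 * b * A ^ 2 * b = 1) :
    A * (b⁻¹ * A * b) * a = a * (b⁻¹ * a * b) * A := by
  have hc : Commute A a := haA.symm
  rw [braid_conj hAb, braid_conj hab]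
  calc A * (A * b * A⁻¹) * a = (A ^ 2 * b * a ^ 2) * (a⁻¹ * A⁻¹) := by
        simp [pow_two, mul_assoc, hc.inv_left.eq]
    _ = a * (a * b * a⁻¹) * A := by
        rw [sphere_swap hs]
        simp [pow_two, mul_assoc, hc.inv_right.eq, hc.inv_right.left_comm]

/-- In the sphere braid group, `aCA = caC` for `c = b⁻¹Ab`, `C = b⁻¹ab`. -/
lemma sphere_mul_conj_mul_conj {a A b : H} (hab : a * b * a = b * a * b)
    (hAb : A * b * A = b * A * b) (haA : a * A = A * a) (hs : a ^ 2 * b * A ^ 2 * b = 1) :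
    a * (b⁻¹ * a * b) * A = (b⁻¹ * A * b) * a * (b⁻¹ * a * b) := by
  have hc : Commute A a := haA.symm
  have hb : a * a * b = b⁻¹ * (A⁻¹ * A⁻¹) := by
    rw [eq_inv_mul_iff_mul_eq, ← mul_inv_rev, eq_inv_iff_mul_eq_one]
    calc b * (a * a * b) * (A * A) = b * (a ^ 2 * b * A ^ 2 * b) * b⁻¹ := by
          simp [pow_two, mul_assoc]
      _ = 1 := by rw [hs]; group
  have hA : b * A⁻¹ * b⁻¹ = A⁻¹ * b⁻¹ * A := by
    rw [← inv_inj]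
    simpa [mul_assoc] using (braid_conj hAb.symm).symm
  rw [braid_conj hAb, braid_conj hab]
  calc a * (a * b * a⁻¹) * A = (a * a * b) * (a⁻¹ * A) := by group
    _ = A * (b * A⁻¹ * b⁻¹) * (A⁻¹ * A⁻¹) * a⁻¹ := by
        rw [hb, hA]
        simp [mul_assoc, hc.inv_inv.eq, hc.symm.inv_left.eq]
    _ = A * b * A⁻¹ * ((a * a * b) * a⁻¹) := by rw [hb]; group
    _ = A * b * A⁻¹ * a * (a * b * a⁻¹) := by group

lemma conj_mul_mul_conj {a A b : H} (hab : a * b * a = b * a * b) (haA : a * A = A * a) :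
    (b⁻¹ * A * b) * a * (b⁻¹ * a * b) = b⁻¹ * a⁻¹ * A⁻¹ * (A ^ 2 * b * a ^ 2) * b := by
  have hc : Commute A a := haA.symm
  calc (b⁻¹ * A * b) * a * (b⁻¹ * a * b) = b⁻¹ * A * (b * a * b⁻¹) * a * b := by group
    _ = b⁻¹ * A * (a⁻¹ * b * a) * a * b := by rw [braid_conj hab.symm]
    _ = b⁻¹ * a⁻¹ * A⁻¹ * (A ^ 2 * b * a ^ 2) * b := by
        simp [pow_two, mul_assoc, hc.inv_right.left_comm]

/-- In the sphere braid group, `caC = CAc` for `c = b⁻¹Ab`, `C = b⁻¹ab`. -/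
lemma sphere_conj_mul_conj {a A b : H} (hab : a * b * a = b * a * b)
    (hAb : A * b * A = b * A * b) (haA : a * A = A * a) (hs : a ^ 2 * b * A ^ 2 * b = 1) :
    (b⁻¹ * A * b) * a * (b⁻¹ * a * b) = (b⁻¹ * a * b) * A * (b⁻¹ * A * b) := by
  have hc : Commute A a := haA.symm
  rw [conj_mul_mul_conj hab haA, conj_mul_mul_conj hAb haA.symm, sphere_swap hs,
    mul_assoc b⁻¹, hc.symm.inv_inv.eq, ← mul_assoc b⁻¹]

/-- The relation at infinity in the sphere braid group. -/
lemma sphere_infinity {a A b : H} (hs : a ^ 2 * b * A ^ 2 * b = 1) :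
    b * (b⁻¹ * A * b) * a * b * (b⁻¹ * a * b) * A = 1 := by
  have h : A * b * a ^ 2 * b * A = 1 := by
    calc A * b * a ^ 2 * b * A = (A * b) * (a ^ 2 * b * A ^ 2 * b) * (A * b)⁻¹ := by
          simp [pow_two, mul_assoc]
      _ = 1 := by rw [hs]; group
  rw [← h]
  simp [pow_two, mul_assoc]

lemma conj_comm_of_comm {a A b : H} (haA : a * A = A * a) :
    b⁻¹ * a * b * (b⁻¹ * A * b) = b⁻¹ * A * b * (b⁻¹ * a * b) := by
  calc b⁻¹ * a * b * (b⁻¹ * A * b) = b⁻¹ * (a * A) * b := by group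
    _ = _ := by rw [haA]; group

lemma commutator_eq_one_of_comm {a A b : H} (hab : a * b * a = b * a * b) (haA : a * A = A * a) :
    (a * b * a⁻¹) * (b⁻¹ * A * b) * (a * b * a⁻¹)⁻¹ * (b⁻¹ * A * b)⁻¹ = 1 := by
  rw [← braid_conj hab, mul_inv_eq_one, mul_inv_eq_iff_eq_mul]
  exact conj_comm_of_comm haA

lemma infinity_of_conj_mul_conj {a A b c C : H} (hab : a * b * a = b * a * b)
    (hcb : c * b * c = b * c * b) (hinf : b * c * a * b * C * A = 1)
    (hA : c * a * C = C * A * c) : b * c * (a * b * a⁻¹) * c * a * C = 1 := by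
  have hab' : a * b = b * (a * b * a⁻¹) := by
    rw [← braid_conj hab]; group
  calc b * c * (a * b * a⁻¹) * c * a * C
      = c⁻¹ * (c * b * c) * (a * b * a⁻¹) * (c * a * C) := by group
    _ = c⁻¹ * (b * c * (b * (a * b * a⁻¹)) * C * A) * c := by rw [hcb, hA]; group
    _ = c⁻¹ * (b * c * a * b * C * A) * c := by rw [← hab']; group
    _ = 1 := by rw [hinf]; group

lemma infinity_of_mul_mul_eq {a A b c C : H} (hinf : b * c * a * b * C * A = 1)
    (hC : a * C * A = c * a * C) : b * c * (a * b * a⁻¹) * c * a * C = 1 := by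
  calc b * c * (a * b * a⁻¹) * c * a * C = b * c * (a * b * a⁻¹) * (c * a * C) := by group
    _ = 1 := by rw [← hC, ← hinf]; group

end Words

section Quotients

lemma t1_braid_t2 : t1 * t2 * t1 = t2 * t1 * t2 :=
  PresentedGroup.mk_eq_mk_of_mul_inv_mem (rels := relsB4) (by simp [relsB4])

lemma t2_braid_t3 : t2 * t3 * t2 = t3 * t2 * t3 :=
  PresentedGroup.mk_eq_mk_of_mul_inv_mem (rels := relsB4) (by simp [relsB4])

lemma t1_comm_t3 : t1 * t3 = t3 * t1 :=
  PresentedGroup.mk_eq_mk_of_mul_inv_mem (rels := relsB4) (by simp [relsB4])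

lemma p1_braid_p2 : p1 * p2 * p1 = p2 * p1 * p2 :=
  congrArg (QuotientGroup.mk : B4 → QB4) t1_braid_t2

lemma p3_braid_p2 : p3 * p2 * p3 = p2 * p3 * p2 :=
  congrArg (QuotientGroup.mk : B4 → QB4) t2_braid_t3.symm

lemma p1_comm_p3 : p1 * p3 = p3 * p1 :=
  congrArg (QuotientGroup.mk : B4 → QB4) t1_comm_t3

lemma QB4_sphere : p1 ^ 2 * p2 * p3 ^ 2 * p2 = 1 :=
  (QuotientGroup.eq_one_iff (t1 ^ 2 * t2 * t3 ^ 2 * t2)).2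
    (Subgroup.subset_normalClosure (Set.mem_singleton _))

/-- The images of the generators `α, ᾱ, β, γ, γ̄`. -/
def toQB4 : Fin 5 → QB4 := ![p1, p3, p2, p2⁻¹ * p3 * p2, p2⁻¹ * p1 * p2]

/-- The quotient of the group presented by `rels` by the commutator `[β₁, γ₁]`. -/
abbrev CommQuotient (rels : Set F5) := PresentedGroup rels ⧸ Subgroup.normalClosure
  ({(.of 0 * .of 2 * (.of 0)⁻¹) * .of 3 * (.of 0 * .of 2 * (.of 0)⁻¹)⁻¹ * (.of 3)⁻¹} :
    Set (PresentedGroup rels))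

/-- The image of a generator in `CommQuotient rels`. -/
def gen (rels : Set F5) (i : Fin 5) : CommQuotient rels :=
  QuotientGroup.mk (PresentedGroup.of i)

/-- Every relator in `rels` holds in `CommQuotient rels`. -/
lemma lift_gen_eq_one {rels : Set F5} {r : F5} (hr : r ∈ rels) :
    FreeGroup.lift (gen rels) r = 1 := by
  have h : FreeGroup.lift (gen rels) =
      (QuotientGroup.mk' _).comp (PresentedGroup.mk rels) := by
    ext i
    exact FreeGroup.lift_apply_of
  rw [h, MonoidHom.comp_apply, PresentedGroup.one_of_mem hr, map_one]

lemma gen_commutator (rels : Set F5) :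
    (gen rels 0 * gen rels 2 * (gen rels 0)⁻¹) * gen rels 3 *
      (gen rels 0 * gen rels 2 * (gen rels 0)⁻¹)⁻¹ * (gen rels 3)⁻¹ = 1 :=
  (QuotientGroup.eq_one_iff _).2 (Subgroup.subset_normalClosure (Set.mem_singleton _))

/-- If the relators in `rels` hold in `QB4`, and the relations of `QB4` hold in
`CommQuotient rels`, then the two groups are isomorphic. -/
lemma exists_mulEquiv_QB4 (rels : Set F5) (hrels : ∀ r ∈ rels, FreeGroup.lift toQB4 r = 1)
    (h₁ : gen rels 0 * gen rels 2 * gen rels 0 = gen rels 2 * gen rels 0 * gen rels 2)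
    (h₂ : gen rels 1 * gen rels 2 * gen rels 1 = gen rels 2 * gen rels 1 * gen rels 2)
    (h : gen rels 0 * gen rels 1 = gen rels 1 * gen rels 0 ∧
      gen rels 3 = (gen rels 2)⁻¹ * gen rels 1 * gen rels 2 ∧
      gen rels 4 = (gen rels 2)⁻¹ * gen rels 0 * gen rels 2 ∧
      gen rels 0 ^ 2 * gen rels 2 * gen rels 1 ^ 2 * gen rels 2 = 1) :
    ∃ e : CommQuotient rels ≃* QB4, ∀ i, e (gen rels i) = toQB4 i := by
  obtain ⟨hcomm, h₃, h₄, hs⟩ := h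
  let f : CommQuotient rels →* QB4 := QuotientGroup.lift _ (PresentedGroup.toGroup hrels) <| by
    refine fun x hx ↦ Subgroup.normalClosure_le_normal (N := MonoidHom.ker _) ?_ hx
    rw [Set.singleton_subset_iff, SetLike.mem_coe, MonoidHom.mem_ker]
    simp only [map_mul, map_inv, PresentedGroup.toGroup.of]
    exact commutator_eq_one_of_comm p1_braid_p2 p1_comm_p3
  have hB4 : ∀ r ∈ relsB4, FreeGroup.lift ![gen rels 0, gen rels 2, gen rels 1] r = 1 := by
    rintro r (rfl | rfl | rfl) <;>
      simp only [map_mul, map_inv, FreeGroup.lift_apply_of, mul_inv_eq_one]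
    exacts [h₁, h₂.symm, hcomm]
  let g : QB4 →* CommQuotient rels := QuotientGroup.lift _ (PresentedGroup.toGroup hB4) <| by
    refine fun x hx ↦ Subgroup.normalClosure_le_normal (N := MonoidHom.ker _) ?_ hx
    rw [Set.singleton_subset_iff, SetLike.mem_coe, MonoidHom.mem_ker]
    simp only [map_mul, map_pow]
    exact hs
  have hf (i) : f (gen rels i) = toQB4 i := PresentedGroup.toGroup.of hrels
  have hg₁ : g p1 = gen rels 0 := PresentedGroup.toGroup.of hB4
  have hg₂ : g p2 = gen rels 2 := PresentedGroup.toGroup.of hB4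
  have hg₃ : g p3 = gen rels 1 := PresentedGroup.toGroup.of hB4
  refine ⟨MonoidHom.toMulEquiv f g ?_ ?_, hf⟩
  · ext i
    change g (f (gen rels i)) = gen rels i
    rw [hf]
    fin_cases i <;> simp [toQB4, hg₁, hg₂, hg₃, h₃, h₄]
  · ext i
    fin_cases i
    · change f (g p1) = p1
      rw [hg₁, hf]; rfl
    · change f (g p2) = p2
      rw [hg₂, hf]; rfl
    · change f (g p3) = p3
      rw [hg₃, hf]; rfl

/-- A group presented by relators containing those of `G̃` has `CommQuotient rels ≃* QB4` as soon
as its relators hold in `QB4` and the relations `bc(aba⁻¹)caC = 1`, `caC = CAc` hold. -/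
lemma exists_mulEquiv_QB4_of_relsT (rels : Set F5) (hT : relsT ⊆ rels)
    (hrels : ∀ r ∈ rels, FreeGroup.lift toQB4 r = 1)
    (hinf : gen rels 2 * gen rels 3 * (gen rels 0 * gen rels 2 * (gen rels 0)⁻¹) * gen rels 3 *
      gen rels 0 * gen rels 4 = 1)
    (h : gen rels 3 * gen rels 0 * gen rels 4 = gen rels 4 * gen rels 1 * gen rels 3) :
    ∃ e : CommQuotient rels ≃* QB4, ∀ i, e (gen rels i) = toQB4 i := by
  have h₁ := lift_gen_eq_one (hT (.inl rfl))
  have h₂ := lift_gen_eq_one (hT (.inr (.inl rfl)))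
  have h₃ := lift_gen_eq_one (hT (.inr (.inr (.inl rfl))))
  have h₄ := lift_gen_eq_one (hT (.inr (.inr (.inr (.inl rfl)))))
  simp only [fa, fa', fb, fc, fc', map_mul, map_inv, FreeGroup.lift_apply_of,
    mul_inv_eq_one] at h₁ h₂ h₃ h₄
  exact exists_mulEquiv_QB4 rels hrels h₁ h₂
    (sphere_relations h₁ h₃ h₄ (gen_commutator rels) hinf h)

lemma lift_toQB4_relsT : ∀ r ∈ relsT, FreeGroup.lift toQB4 r = 1 := by
  rintro r (rfl | rfl | rfl | rfl | rfl) <;>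
    simp only [fa, fa', fb, fc, fc', map_mul, map_inv, FreeGroup.lift_apply_of, mul_inv_eq_one]
  exacts [p1_braid_p2, p3_braid_p2, braid_conj_left p3_braid_p2, braid_conj_left p1_braid_p2,
    sphere_infinity QB4_sphere]

lemma lift_toQB4_rels1 : ∀ r ∈ rels1, FreeGroup.lift toQB4 r = 1 := by
  rintro r (hr | rfl | rfl | rfl | rfl)
  · exact lift_toQB4_relsT r hr
  all_goals
    simp only [fa, fa', fc, fc', map_mul, map_inv, FreeGroup.lift_apply_of, mul_inv_eq_one]
  · exact braid_conj_right p1_braid_p2 p3_braid_p2 p1_comm_p3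
  · exact braid_conj_right p3_braid_p2 p1_braid_p2 p1_comm_p3.symm
  · exact sphere_conj_mul_conj p1_braid_p2 p3_braid_p2 p1_comm_p3 QB4_sphere
  · exact conj_comm_of_comm p1_comm_p3.symm

lemma lift_toQB4_rels2 : ∀ r ∈ rels2, FreeGroup.lift toQB4 r = 1 := by
  rintro r (hr | rfl | rfl | rfl)
  · exact lift_toQB4_relsT r hr
  all_goals
    simp only [fa, fa', fc, fc', map_mul, map_inv, FreeGroup.lift_apply_of, mul_inv_eq_one]
  · exact sphere_mul_conj_mul p1_braid_p2 p3_braid_p2 p1_comm_p3 QB4_sphere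
  · exact sphere_mul_conj_mul_conj p1_braid_p2 p3_braid_p2 p1_comm_p3 QB4_sphere
  · exact sphere_conj_mul_conj p1_braid_p2 p3_braid_p2 p1_comm_p3 QB4_sphere

lemma exists_mulEquiv_QB4_rels1 :
    ∃ e : CommQuotient rels1 ≃* QB4, ∀ i, e (gen rels1 i) = toQB4 i := by
  have hab := lift_gen_eq_one (rels := rels1) (.inl (.inl rfl))
  have hcb := lift_gen_eq_one (rels := rels1) (.inl (.inr (.inr (.inl rfl))))
  have hinf := lift_gen_eq_one (rels := rels1) (.inl (.inr (.inr (.inr (.inr rfl)))))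
  have hA := lift_gen_eq_one (rels := rels1) (.inr (.inr (.inr (.inl rfl))))
  simp only [fa, fa', fb, fc, fc', map_mul, map_inv, FreeGroup.lift_apply_of,
    mul_inv_eq_one] at hab hcb hinf hA
  exact exists_mulEquiv_QB4_of_relsT rels1 Set.subset_union_left lift_toQB4_rels1
    (infinity_of_conj_mul_conj hab hcb hinf hA) hA

lemma exists_mulEquiv_QB4_rels2 :
    ∃ e : CommQuotient rels2 ≃* QB4, ∀ i, e (gen rels2 i) = toQB4 i := by
  have hinf := lift_gen_eq_one (rels := rels2) (.inl (.inr (.inr (.inr (.inr rfl)))))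
  have hC := lift_gen_eq_one (rels := rels2) (.inr (.inr (.inl rfl)))
  have hA := lift_gen_eq_one (rels := rels2) (.inr (.inr (.inr rfl)))
  simp only [fa, fa', fb, fc, fc', map_mul, map_inv, FreeGroup.lift_apply_of,
    mul_inv_eq_one] at hinf hC hA
  exact exists_mulEquiv_QB4_of_relsT rels2 Set.subset_union_left lift_toQB4_rels2
    (infinity_of_mul_mul_eq hinf hC) hA

end Quotients

end Sextics

open Sextics

/-- Lemma `A5[]` of the paper: with `β₁ = αβα⁻¹` and `γ₁ = γ`, the assignment `α ↦ σ₁`,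
`ᾱ ↦ σ₃`, `β ↦ σ₂`, `γ ↦ σ₂⁻¹σ₃σ₂`, `γ̄ ↦ σ₂⁻¹σ₁σ₂` induces isomorphisms
`G₂/⟪[β₁,γ₁]⟫ ≅ B₄/⟪σ₁²σ₂σ₃²σ₂⟫` and `G₁/⟪[β₁,γ₁]⟫ ≅ B₄/⟪σ₁²σ₂σ₃²σ₂⟫`. -/
theorem perturbed_A5_commuting_groups :
    (∃ e : (G2 ⧸ Subgroup.normalClosure
          ({(a2 * b2 * a2⁻¹) * c2 * (a2 * b2 * a2⁻¹)⁻¹ * c2⁻¹} : Set G2)) ≃* QB4,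
        e (QuotientGroup.mk a2) = p1 ∧ e (QuotientGroup.mk a2') = p3 ∧
        e (QuotientGroup.mk b2) = p2 ∧
        e (QuotientGroup.mk c2) = QuotientGroup.mk (t2⁻¹ * t3 * t2) ∧
        e (QuotientGroup.mk c2') = QuotientGroup.mk (t2⁻¹ * t1 * t2)) ∧
    (∃ e : (G1 ⧸ Subgroup.normalClosure
          ({(a1 * b1 * a1⁻¹) * c1 * (a1 * b1 * a1⁻¹)⁻¹ * c1⁻¹} : Set G1)) ≃* QB4,
        e (QuotientGroup.mk a1) = p1 ∧ e (QuotientGroup.mk a1') = p3 ∧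
        e (QuotientGroup.mk b1) = p2 ∧
        e (QuotientGroup.mk c1) = QuotientGroup.mk (t2⁻¹ * t3 * t2) ∧
        e (QuotientGroup.mk c1') = QuotientGroup.mk (t2⁻¹ * t1 * t2)) := by
  obtain ⟨e₂, he₂⟩ := exists_mulEquiv_QB4_rels2
  obtain ⟨e₁, he₁⟩ := exists_mulEquiv_QB4_rels1
  exact ⟨⟨e₂, he₂ 0, he₂ 1, he₂ 2, he₂ 3, he₂ 4⟩, e₁, he₁ 0, he₁ 1, he₁ 2, he₁ 3, he₁ 4⟩
end

section
/- The assignment α ↦ α, ᾱ ↦ α, β ↦ β, γ ↦ γ, γ̄ ↦ γ induces a well-defined surjective group homomorphism G₁ → G₀ (equivalently, G₀ is isomorphic to the quotient of G₁ by the normal closure of {αᾱ⁻¹, γγ̄⁻¹}), and this surjection is not injective. -/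
open Sextics

namespace Sextics

/-- A map of the generators killing the relators of `G₁` extends to `G₁`. -/
lemma exists_hom_G1 {H : Type*} [Group H] (a a' b c c' : H)
    (hab : a * b * a = b * a * b) (hab' : a' * b * a' = b * a' * b)
    (hcb : c * b * c = b * c * b) (hcb' : c' * b * c' = b * c' * b)
    (hinf : b * c * a * b * c' * a' = 1) (hac : a * c * a = c * a * c)
    (hac' : a' * c' * a' = c' * a' * c') (hconj : c * a * c' = c' * a' * c)
    (hcc : c * c' = c' * c) :
    ∃ φ : G1 →* H, φ a1 = a ∧ φ a1' = a' ∧ φ b1 = b ∧ φ c1 = c ∧ φ c1' = c' := by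
  have h : ∀ r ∈ rels1, FreeGroup.lift ![a, a', b, c, c'] r = 1 := by
    intro r hr
    simp only [rels1, relsT, Set.mem_union, Set.mem_insert_iff, Set.mem_singleton_iff] at hr
    rcases hr with (rfl | rfl | rfl | rfl | rfl) | (rfl | rfl | rfl | rfl) <;>
      simp only [fa, fa', fb, fc, fc', map_mul, map_inv, FreeGroup.lift_apply_of,
        mul_inv_eq_one] <;>
      assumption
  exact ⟨PresentedGroup.toGroup h, PresentedGroup.toGroup.of h, PresentedGroup.toGroup.of h,
    PresentedGroup.toGroup.of h, PresentedGroup.toGroup.of h, PresentedGroup.toGroup.of h⟩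

/-- A map of the generators killing the relators of `G₀` extends to `G₀`. -/
lemma exists_hom_G0 {H : Type*} [Group H] (a b c : H)
    (hab : a * b * a = b * a * b) (hbc : b * c * b = c * b * c)
    (hca : c * a * c = a * c * a) (hinf : (a * b * c) ^ 2 = 1) :
    ∃ ψ : G0 →* H, ψ a0 = a ∧ ψ b0 = b ∧ ψ c0 = c := by
  have h : ∀ r ∈ rels0, FreeGroup.lift ![a, b, c] r = 1 := by
    intro r hr
    simp only [rels0, Set.mem_insert_iff, Set.mem_singleton_iff] at hr
    rcases hr with rfl | rfl | rfl | rfl <;>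
      simp only [map_mul, map_inv, map_pow, FreeGroup.lift_apply_of, mul_inv_eq_one] <;>
      assumption
  exact ⟨PresentedGroup.toGroup h, PresentedGroup.toGroup.of h, PresentedGroup.toGroup.of h,
    PresentedGroup.toGroup.of h⟩

lemma braid_a0_b0 : a0 * b0 * a0 = b0 * a0 * b0 :=
  mul_inv_eq_one.mp (PresentedGroup.one_of_mem (by simp [rels0]))

lemma braid_b0_c0 : b0 * c0 * b0 = c0 * b0 * c0 :=
  mul_inv_eq_one.mp (PresentedGroup.one_of_mem (by simp [rels0]))

lemma braid_c0_a0 : c0 * a0 * c0 = a0 * c0 * a0 :=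
  mul_inv_eq_one.mp (PresentedGroup.one_of_mem (by simp [rels0]))

lemma a0_b0_c0_sq : (a0 * b0 * c0) ^ 2 = 1 :=
  PresentedGroup.one_of_mem (rels := rels0)
    (x := (FreeGroup.of 0 * FreeGroup.of 1 * FreeGroup.of 2) ^ 2) (by simp [rels0])

lemma braid_a1_b1 : a1 * b1 * a1 = b1 * a1 * b1 :=
  mul_inv_eq_one.mp (PresentedGroup.one_of_mem (x := fa * fb * fa * (fb * fa * fb)⁻¹)
    (by simp [rels1, relsT]))

lemma braid_c1_b1 : c1 * b1 * c1 = b1 * c1 * b1 :=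
  mul_inv_eq_one.mp (PresentedGroup.one_of_mem (x := fc * fb * fc * (fb * fc * fb)⁻¹)
    (by simp [rels1, relsT]))

lemma braid_a1_c1 : a1 * c1 * a1 = c1 * a1 * c1 :=
  mul_inv_eq_one.mp (PresentedGroup.one_of_mem (x := fa * fc * fa * (fc * fa * fc)⁻¹)
    (by simp [rels1]))

lemma relation_at_infinity_G1 : b1 * c1 * a1 * b1 * c1' * a1' = 1 :=
  PresentedGroup.one_of_mem (x := fb * fc * fa * fb * fc' * fa') (by simp [rels1, relsT])

/-- The elements `(αβγ)²` and `(βγα)²` are conjugate, so one is trivial iff the other is. -/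
lemma sq_rotate_eq_one_iff {H : Type*} [Group H] (a b c : H) :
    (a * b * c) ^ 2 = 1 ↔ b * c * a * b * c * a = 1 := by
  have h : b * c * a * b * c * a = a⁻¹ * (a * b * c) ^ 2 * a⁻¹⁻¹ := by
    simp [pow_two, mul_assoc]
  rw [h, conj_eq_one_iff]

/-- The generators `α` and `ᾱ` of `G₁` are sent to the distinct transpositions `(1 2)` and `(0 3)`
by a homomorphism to the symmetric group of degree four. -/
lemma a1_ne_a1' : a1 ≠ a1' := by
  obtain ⟨φ, ha, ha', -⟩ := exists_hom_G1 (H := Equiv.Perm (Fin 4))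
    (Equiv.swap 1 2) (Equiv.swap 0 3) (Equiv.swap 0 1) (Equiv.swap 1 3) (Equiv.swap 0 2)
    (by decide) (by decide) (by decide) (by decide) (by decide) (by decide) (by decide)
    (by decide) (by decide)
  intro h
  rw [h, ha'] at ha
  exact absurd ha (by decide)

lemma hom_ext_G1 {H : Type*} [Group H] {φ ψ : G1 →* H} (ha : φ a1 = ψ a1) (ha' : φ a1' = ψ a1')
    (hb : φ b1 = ψ b1) (hc : φ c1 = ψ c1) (hc' : φ c1' = ψ c1') : φ = ψ := by
  refine PresentedGroup.ext fun i => ?_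
  fin_cases i <;> assumption

lemma hom_ext_G0 {H : Type*} [Group H] {φ ψ : G0 →* H} (ha : φ a0 = ψ a0) (hb : φ b0 = ψ b0)
    (hc : φ c0 = ψ c0) : φ = ψ := by
  refine PresentedGroup.ext fun i => ?_
  fin_cases i <;> assumption

end Sextics

/-- The assignment `α ↦ α`, `ᾱ ↦ α`, `β ↦ β`, `γ ↦ γ`, `γ̄ ↦ γ` induces a well-defined
surjective homomorphism `G₁ → G₀` (equivalently, `G₀` is isomorphic to the quotient of
`G₁` by the normal closure of `{αᾱ⁻¹, γγ̄⁻¹}`), and this surjection is not injective. -/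
theorem perturbation_epimorphism_not_injective :
    (∃ φ : G1 →* G0,
        φ a1 = a0 ∧ φ a1' = a0 ∧ φ b1 = b0 ∧ φ c1 = c0 ∧ φ c1' = c0 ∧
        Function.Surjective φ ∧ ¬ Function.Injective φ) ∧
    (∃ e : (G1 ⧸ Subgroup.normalClosure ({a1 * a1'⁻¹, c1 * c1'⁻¹} : Set G1)) ≃* G0,
        e (QuotientGroup.mk a1) = a0 ∧ e (QuotientGroup.mk a1') = a0 ∧
        e (QuotientGroup.mk b1) = b0 ∧ e (QuotientGroup.mk c1) = c0 ∧
        e (QuotientGroup.mk c1') = c0) := by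
  obtain ⟨φ, ha, ha', hb, hc, hc'⟩ := exists_hom_G1 a0 a0 b0 c0 c0 braid_a0_b0 braid_a0_b0
    braid_b0_c0.symm braid_b0_c0.symm ((sq_rotate_eq_one_iff _ _ _).mp a0_b0_c0_sq)
    braid_c0_a0.symm braid_c0_a0.symm rfl rfl
  set N := Subgroup.normalClosure ({a1 * a1'⁻¹, c1 * c1'⁻¹} : Set G1)
  let π : G1 →* G1 ⧸ N := QuotientGroup.mk' N
  have hπa : π a1' = π a1 := by
    rw [eq_comm, ← mul_inv_eq_one, ← map_inv, ← map_mul]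
    exact (QuotientGroup.eq_one_iff _).mpr (Subgroup.subset_normalClosure (by simp))
  have hπc : π c1' = π c1 := by
    rw [eq_comm, ← mul_inv_eq_one, ← map_inv, ← map_mul]
    exact (QuotientGroup.eq_one_iff _).mpr (Subgroup.subset_normalClosure (by simp))
  obtain ⟨ψ, ψa, ψb, ψc⟩ := exists_hom_G0 (π a1) (π b1) (π c1)
    (by simpa only [map_mul] using congrArg π braid_a1_b1)
    (by simpa only [map_mul] using congrArg π braid_c1_b1.symm)
    (by simpa only [map_mul] using congrArg π braid_a1_c1.symm)
    ((sq_rotate_eq_one_iff _ _ _).mpr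
      (by simpa only [map_mul, map_one, hπa, hπc] using congrArg π relation_at_infinity_G1))
  have hN : N ≤ φ.ker := Subgroup.normalClosure_le_normal (by
    rintro x (rfl | rfl) <;> simp [MonoidHom.mem_ker, ha, ha', hc, hc'])
  let φN : G1 ⧸ N →* G0 := QuotientGroup.lift N φ hN
  have hφN : ∀ g, φN (π g) = φ g := fun g => QuotientGroup.lift_mk' N hN g
  have hright : φN.comp ψ = MonoidHom.id G0 := hom_ext_G0
    (by simp [ψa, hφN, ha]) (by simp [ψb, hφN, hb]) (by simp [ψc, hφN, hc])
  have hleft : ψ.comp φN = MonoidHom.id (G1 ⧸ N) := QuotientGroup.monoidHom_ext N <|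
    show (ψ.comp φN).comp π = π from hom_ext_G1
      (by simp [hφN, ha, ψa]) (by simp [hπa, hφN, ha, ψa]) (by simp [hφN, hb, ψb])
      (by simp [hφN, hc, ψc]) (by simp [hπc, hφN, hc, ψc])
  have hsurj : Function.Surjective φ := fun y => by
    obtain ⟨x, hx⟩ := QuotientGroup.mk'_surjective N (ψ y)
    refine ⟨x, ?_⟩
    rw [← hφN, show π x = ψ y from hx]
    exact DFunLike.congr_fun hright y
  exact ⟨⟨φ, ha, ha', hb, hc, hc', hsurj, fun hinj => a1_ne_a1' (hinj (ha.trans ha'.symm))⟩,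
    MonoidHom.toMulEquiv φN ψ hleft hright, ha, ha', hb, hc, hc'⟩
end

section
/- Let R₁ and R₂ be two distinct elements of the set {αβ⁻¹, γβ⁻¹, αγ⁻¹, (αβα⁻¹)γ(αβα⁻¹)⁻¹γ⁻¹}. Then for each m ∈ {0, 1, 2}, the quotient of G_m by the normal closure of {R₁, R₂} is isomorphic to the cyclic group ℤ/6. -/
namespace Sextics

/-- The four perturbation relations `αβ⁻¹`, `γβ⁻¹`, `αγ⁻¹`, `[αβα⁻¹, γ]` in `G₀`. -/
def S0 : Set G0 :=
  {a0 * b0⁻¹, c0 * b0⁻¹, a0 * c0⁻¹, (a0 * b0 * a0⁻¹) * c0 * (a0 * b0 * a0⁻¹)⁻¹ * c0⁻¹}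

/-- The four perturbation relations in `G₁`. -/
def S1 : Set G1 :=
  {a1 * b1⁻¹, c1 * b1⁻¹, a1 * c1⁻¹, (a1 * b1 * a1⁻¹) * c1 * (a1 * b1 * a1⁻¹)⁻¹ * c1⁻¹}

/-- The four perturbation relations in `G₂`. -/
def S2 : Set G2 :=
  {a2 * b2⁻¹, c2 * b2⁻¹, a2 * c2⁻¹, (a2 * b2 * a2⁻¹) * c2 * (a2 * b2 * a2⁻¹)⁻¹ * c2⁻¹}

end Sextics

open Sextics

section

variable {H : Type*} [Group H]

theorem eq_of_braid_of_commute {x y : H} (h : x * y * x = y * x * y) (hc : x * y = y * x) :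
    x = y := by
  rw [hc] at h
  exact mul_left_cancel h

/-- A value of one of the four perturbation relations at a triple of group elements. -/
def IsPerturbation (a b c r : H) : Prop :=
  r = a * b⁻¹ ∨ r = c * b⁻¹ ∨ r = a * c⁻¹ ∨
    r = (a * b * a⁻¹) * c * (a * b * a⁻¹)⁻¹ * c⁻¹

theorem eq_of_commutator_left {a c : H} (h : c * a * c = a * c * a)
    (hr : (a * a * a⁻¹) * c * (a * a * a⁻¹)⁻¹ * c⁻¹ = 1) : c = a := by
  refine eq_of_braid_of_commute h ?_
  rw [mul_inv_eq_one, mul_inv_eq_iff_eq_mul] at hr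
  simpa using hr.symm

theorem eq_of_commutator_right {a b : H} (h : a * b * a = b * a * b)
    (hr : (a * b * a⁻¹) * b * (a * b * a⁻¹)⁻¹ * b⁻¹ = 1) : a = b := by
  have e : a * b * a⁻¹ = b⁻¹ * a * b := by
    rw [mul_inv_eq_iff_eq_mul, mul_assoc, mul_assoc, eq_inv_mul_iff_mul_eq]
    simpa [mul_assoc] using h.symm
  rw [e, mul_inv_eq_one, mul_inv_eq_iff_eq_mul] at hr
  have hr' : a * (b * b) = a * (b * a) := by
    simpa [mul_assoc, inv_mul_eq_iff_eq_mul, ← mul_assoc b a b, ← h] using hr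
  exact (mul_left_cancel (mul_left_cancel hr')).symm

theorem eq_of_commutator_outer {a b : H} (h : a * b * a = b * a * b)
    (hr : (a * b * a⁻¹) * a * (a * b * a⁻¹)⁻¹ * a⁻¹ = 1) : a = b := by
  refine eq_of_braid_of_commute h ?_
  rw [mul_inv_eq_one, mul_inv_eq_iff_eq_mul, inv_mul_cancel_right, mul_assoc] at hr
  exact (eq_mul_inv_iff_mul_eq.1 ((mul_left_cancel hr).trans (mul_assoc _ _ _).symm)).symm

/-- A homomorphism killing two distinct perturbation relations of `a, b, c` identifies the images
of the three elements, provided those images satisfy braid relations. -/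
theorem eq_and_eq_of_isPerturbation {G : Type*} [Group G] (f : G →* H) {a b c r s : G}
    (hr : IsPerturbation a b c r) (hs : IsPerturbation a b c s) (hrs : r ≠ s)
    (hfr : f r = 1) (hfs : f s = 1)
    (hab : f a * f b * f a = f b * f a * f b) (hcb : f c * f b * f c = f b * f c * f b) :
    f b = f a ∧ f c = f a := by
  rcases hr with rfl | rfl | rfl | rfl <;> rcases hs with rfl | rfl | rfl | rfl <;>
    try exact absurd rfl hrs
  all_goals simp only [map_mul, map_inv] at hfr hfs
  all_goals
    generalize f a = x at *
    generalize f b = y at *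
    generalize f c = z at *
    clear hrs
    simp only [mul_inv_eq_one (b := y), mul_inv_eq_one (a := x) (b := z)] at hfr hfs
  all_goals
    first
    | subst hfr
    | subst hfs
  all_goals
    first
    | exact ⟨hfs.symm, rfl⟩
    | exact ⟨rfl, hfs.symm⟩
    | exact ⟨hfs.symm, hfs.symm⟩
    | exact ⟨rfl, hfs⟩
    | exact ⟨hfs, rfl⟩
    | exact ⟨rfl, eq_of_commutator_left hcb hfs⟩
    | exact ⟨rfl, eq_of_commutator_left hcb hfr⟩
    | exact ⟨(eq_of_commutator_right hab hfs).symm, (eq_of_commutator_right hab hfs).symm⟩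
    | exact ⟨(eq_of_commutator_right hab hfr).symm, (eq_of_commutator_right hab hfr).symm⟩
    | exact ⟨(eq_of_commutator_outer hab hfs).symm, rfl⟩
    | exact ⟨(eq_of_commutator_outer hab hfr).symm, rfl⟩

end

theorem IsPerturbation.map_eq_one {G A : Type*} [Group G] [CommGroup A] (f : G →* A)
    {a b c r : G} (hb : f b = f a) (hc : f c = f a) (h : IsPerturbation a b c r) : f r = 1 := by
  rcases h with rfl | rfl | rfl | rfl <;> simp [hb, hc]

/-- A group whose generators all coincide, of exponent `6`, and mapping onto `ℤ/6`. -/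
theorem nonempty_quotient_mulEquiv_zmod {ι : Type*} {rels : Set (FreeGroup ι)}
    (N : Subgroup (PresentedGroup rels)) [N.Normal]
    (φ : PresentedGroup rels →* Multiplicative (ZMod 6)) (hN : N ≤ φ.ker) (i₀ : ι)
    (hφ : φ (PresentedGroup.of i₀) = Multiplicative.ofAdd 1)
    (hgen : ∀ i, QuotientGroup.mk' N (PresentedGroup.of i) =
      QuotientGroup.mk' N (PresentedGroup.of i₀))
    (hpow : QuotientGroup.mk' N (PresentedGroup.of i₀) ^ 6 = 1) :
    Nonempty ((PresentedGroup rels ⧸ N) ≃* Multiplicative (ZMod 6)) := by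
  set x := QuotientGroup.mk' N (PresentedGroup.of i₀) with hx
  let ψ : (PresentedGroup rels ⧸ N) →* Multiplicative (ZMod 6) := QuotientGroup.lift N φ hN
  have hψ : ψ x = Multiplicative.ofAdd 1 := hφ
  have hψz (k : ℤ) : ψ (x ^ k) = Multiplicative.ofAdd (k : ZMod 6) := by
    rw [map_zpow, hψ, ← ofAdd_zsmul, zsmul_one]
  have hall (y : PresentedGroup rels ⧸ N) : y ∈ Subgroup.zpowers x := by
    obtain ⟨g, rfl⟩ := QuotientGroup.mk'_surjective N y
    have hle : Subgroup.closure (Set.range (PresentedGroup.of (rels := rels))) ≤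
        (Subgroup.zpowers x).comap (QuotientGroup.mk' N) := by
      rw [Subgroup.closure_le]
      rintro _ ⟨i, rfl⟩
      exact Subgroup.mem_comap.2 (hgen i ▸ Subgroup.mem_zpowers x)
    rw [PresentedGroup.closure_range_of] at hle
    exact hle (Subgroup.mem_top g)
  refine ⟨MulEquiv.ofBijective ψ ⟨?_, ?_⟩⟩
  · rw [injective_iff_map_eq_one]
    intro y hy
    obtain ⟨k, rfl⟩ := Subgroup.mem_zpowers_iff.1 (hall y)
    rw [hψz, ofAdd_eq_one] at hy
    obtain ⟨m, rfl⟩ := (ZMod.intCast_zmod_eq_zero_iff_dvd k 6).1 hy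
    have h6 : x ^ (6 : ℤ) = 1 := by exact_mod_cast hpow
    rw [Nat.cast_ofNat, zpow_mul, h6, one_zpow]
  · intro z
    obtain ⟨k, hk⟩ := ZMod.intCast_surjective z.toAdd
    exact ⟨x ^ k, by rw [hψz, hk, ofAdd_toAdd]⟩

theorem map_normalClosure_pair_eq_one {G : Type*} [Group G] (r s : G) :
    QuotientGroup.mk' (Subgroup.normalClosure {r, s}) r = 1 ∧
      QuotientGroup.mk' (Subgroup.normalClosure {r, s}) s = 1 :=
  ⟨(QuotientGroup.eq_one_iff r).2 (Subgroup.subset_normalClosure (by simp)),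
    (QuotientGroup.eq_one_iff s).2 (Subgroup.subset_normalClosure (by simp))⟩

theorem normalClosure_pair_le_ker {G A : Type*} [Group G] [Group A] (f : G →* A) {r s : G}
    (hr : f r = 1) (hs : f s = 1) : Subgroup.normalClosure {r, s} ≤ f.ker :=
  Subgroup.normalClosure_le_normal (by
    rintro _ (rfl | rfl)
    exacts [hr, hs])

/-- The homomorphism to `ℤ/6` sending every generator to `1`. -/
def degreeMod {ι : Type*} (rels : Set (FreeGroup ι))
    (h : ∀ r ∈ rels, FreeGroup.lift (fun _ => Multiplicative.ofAdd (1 : ZMod 6)) r = 1) :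
    PresentedGroup rels →* Multiplicative (ZMod 6) :=
  PresentedGroup.toGroup h

theorem degreeMod_of {ι : Type*} {rels : Set (FreeGroup ι)}
    (h : ∀ r ∈ rels, FreeGroup.lift (fun _ => Multiplicative.ofAdd (1 : ZMod 6)) r = 1) (i : ι) :
    degreeMod rels h (PresentedGroup.of i) = Multiplicative.ofAdd 1 :=
  PresentedGroup.toGroup.of h

theorem lift_rels0 : ∀ r ∈ rels0,
    FreeGroup.lift (fun _ => Multiplicative.ofAdd (1 : ZMod 6)) r = 1 := by
  rintro _ (rfl | rfl | rfl | rfl) <;>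
    simp only [map_mul, map_inv, map_pow, FreeGroup.lift_apply_of] <;> decide

theorem lift_relsT : ∀ r ∈ relsT,
    FreeGroup.lift (fun _ => Multiplicative.ofAdd (1 : ZMod 6)) r = 1 := by
  rintro _ (rfl | rfl | rfl | rfl | rfl) <;>
    simp only [fa, fa', fb, fc, fc', map_mul, map_inv, FreeGroup.lift_apply_of] <;> decide

theorem lift_rels1 : ∀ r ∈ rels1,
    FreeGroup.lift (fun _ => Multiplicative.ofAdd (1 : ZMod 6)) r = 1 := by
  rintro r (h | rfl | rfl | rfl | rfl)
  · exact lift_relsT r h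
  all_goals simp only [fa, fa', fc, fc', map_mul, map_inv, FreeGroup.lift_apply_of]; decide

theorem lift_rels2 : ∀ r ∈ rels2,
    FreeGroup.lift (fun _ => Multiplicative.ofAdd (1 : ZMod 6)) r = 1 := by
  rintro r (h | rfl | rfl | rfl)
  · exact lift_relsT r h
  all_goals simp only [fa, fa', fc, fc', map_mul, map_inv, FreeGroup.lift_apply_of]; decide

section

variable {H : Type*} [Group H]

theorem hom_relator_eq_one {ι : Type*} {rels : Set (FreeGroup ι)} (f : PresentedGroup rels →* H)
    {r : FreeGroup ι} (h : r ∈ rels) : f (PresentedGroup.mk rels r) = 1 := by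
  rw [PresentedGroup.one_of_mem h, map_one]

theorem rels0_hom (f : G0 →* H) :
    f a0 * f b0 * f a0 = f b0 * f a0 * f b0 ∧ f c0 * f b0 * f c0 = f b0 * f c0 * f b0 ∧
      (f a0 * f b0 * f c0) ^ 2 = 1 := by
  refine ⟨mul_inv_eq_one.1 ?_, (mul_inv_eq_one.1 ?_).symm, ?_⟩ <;>
    simp only [← map_mul, ← map_inv, ← map_pow]
  exacts [hom_relator_eq_one f (.inl rfl), hom_relator_eq_one f (.inr (.inl rfl)),
    hom_relator_eq_one f (.inr (.inr (.inr rfl)))]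

theorem rels1_hom (f : G1 →* H) :
    f a1 * f b1 * f a1 = f b1 * f a1 * f b1 ∧ f c1 * f b1 * f c1 = f b1 * f c1 * f b1 ∧
      f c1' * f b1 * f c1' = f b1 * f c1' * f b1 ∧
      f b1 * f c1 * f a1 * f b1 * f c1' * f a1' = 1 ∧
      f c1 * f a1 * f c1' = f c1' * f a1' * f c1 ∧ f c1 * f c1' = f c1' * f c1 := by
  refine ⟨mul_inv_eq_one.1 ?_, mul_inv_eq_one.1 ?_, mul_inv_eq_one.1 ?_, ?_,
    mul_inv_eq_one.1 ?_, mul_inv_eq_one.1 ?_⟩ <;>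
    simp only [← map_mul, ← map_inv]
  exacts [hom_relator_eq_one f (.inl (.inl rfl)),
    hom_relator_eq_one f (.inl (.inr (.inr (.inl rfl)))),
    hom_relator_eq_one f (.inl (.inr (.inr (.inr (.inl rfl))))),
    hom_relator_eq_one f (.inl (.inr (.inr (.inr (.inr rfl))))),
    hom_relator_eq_one f (.inr (.inr (.inr (.inl rfl)))),
    hom_relator_eq_one f (.inr (.inr (.inr (.inr rfl))))]

theorem rels2_hom (f : G2 →* H) :
    f a2 * f b2 * f a2 = f b2 * f a2 * f b2 ∧ f c2 * f b2 * f c2 = f b2 * f c2 * f b2 ∧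
      f b2 * f c2 * f a2 * f b2 * f c2' * f a2' = 1 ∧
      f a2' * f c2 * f a2 = f a2 * f c2' * f a2' ∧
      f a2 * f c2' * f a2' = f c2 * f a2 * f c2' ∧
      f c2 * f a2 * f c2' = f c2' * f a2' * f c2 := by
  refine ⟨mul_inv_eq_one.1 ?_, mul_inv_eq_one.1 ?_, ?_,
    mul_inv_eq_one.1 ?_, mul_inv_eq_one.1 ?_, mul_inv_eq_one.1 ?_⟩ <;>
    simp only [← map_mul, ← map_inv]
  exacts [hom_relator_eq_one f (.inl (.inl rfl)),
    hom_relator_eq_one f (.inl (.inr (.inr (.inl rfl)))),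
    hom_relator_eq_one f (.inl (.inr (.inr (.inr (.inr rfl))))),
    hom_relator_eq_one f (.inr (.inl rfl)),
    hom_relator_eq_one f (.inr (.inr (.inl rfl))),
    hom_relator_eq_one f (.inr (.inr (.inr rfl)))]

/-- `p` and `q` play the roles of `ᾱ` and `γ̄` in `G₁` once `α = β = γ = x`. -/
theorem bar_eq_of_commute {x p q : H} (hq : q * x * q = x * q * x)
    (hinf : x * x * x * x * q * p = 1) (h : x * x * q = q * p * x) (hc : x * q = q * x) :
    p = x ∧ q = x ∧ x ^ 6 = 1 := by
  obtain rfl : q = x := eq_of_braid_of_commute hq hc.symm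
  obtain rfl : p = q := by simpa [mul_assoc] using h.symm
  exact ⟨rfl, rfl, by simpa [pow_succ] using hinf⟩

/-- `p` and `q` play the roles of `ᾱ` and `γ̄` in `G₂` once `α = β = γ = x`. -/
theorem bar_eq_of_triple {x p q : H} (hinf : x * x * x * x * q * p = 1)
    (h₁ : p * x * x = x * q * p) (h₂ : x * q * p = x * x * q) :
    p = x ∧ q = x ∧ x ^ 6 = 1 := by
  have hqp : q * p = x * q := by simpa [mul_assoc] using h₂
  have hq : x * x * x * x * (x * q) = 1 := by rw [← hqp, ← mul_assoc]; exact hinf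
  have hq' : q = (x ^ 5)⁻¹ := eq_inv_of_mul_eq_one_right (by
    simpa [pow_succ, mul_assoc] using hq)
  have hcomm : q * x = x * q := by
    rw [hq']
    group
  obtain rfl : p = x := mul_left_cancel (hqp.trans hcomm.symm)
  obtain rfl : q = p := by
    rw [mul_assoc p q p, hcomm] at h₁
    simpa [mul_assoc] using h₁.symm
  exact ⟨rfl, rfl, by simpa [pow_succ] using hinf⟩

end

theorem nonempty_G0_quotient {r s : G0} (hr : r ∈ S0) (hs : s ∈ S0) (hrs : r ≠ s) :
    Nonempty ((G0 ⧸ Subgroup.normalClosure {r, s}) ≃* Multiplicative (ZMod 6)) := by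
  let π := QuotientGroup.mk' (Subgroup.normalClosure {r, s})
  obtain ⟨hπr, hπs⟩ := map_normalClosure_pair_eq_one r s
  obtain ⟨hab, hcb, hinf⟩ := rels0_hom π
  obtain ⟨hb, hc⟩ := eq_and_eq_of_isPerturbation π hr hs hrs hπr hπs hab hcb
  have hφ := degreeMod_of lift_rels0
  have hone {t : G0} (ht : t ∈ S0) : degreeMod rels0 lift_rels0 t = 1 :=
    IsPerturbation.map_eq_one _ ((hφ 1).trans (hφ 0).symm) ((hφ 2).trans (hφ 0).symm) ht
  refine nonempty_quotient_mulEquiv_zmod _ (degreeMod rels0 lift_rels0)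
    (normalClosure_pair_le_ker _ (hone hr) (hone hs)) 0 (hφ 0) ?_ ?_
  · intro i
    fin_cases i
    exacts [rfl, hb, hc]
  · rw [hb, hc] at hinf
    change π a0 ^ 6 = 1
    simpa only [pow_succ, pow_zero, one_mul, mul_assoc] using hinf

theorem nonempty_G1_quotient {r s : G1} (hr : r ∈ S1) (hs : s ∈ S1) (hrs : r ≠ s) :
    Nonempty ((G1 ⧸ Subgroup.normalClosure {r, s}) ≃* Multiplicative (ZMod 6)) := by
  let π := QuotientGroup.mk' (Subgroup.normalClosure {r, s})
  obtain ⟨hπr, hπs⟩ := map_normalClosure_pair_eq_one r s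
  obtain ⟨hab, hcb, hcb', hinf, htri, hcc⟩ := rels1_hom π
  obtain ⟨hb, hc⟩ := eq_and_eq_of_isPerturbation π hr hs hrs hπr hπs hab hcb
  rw [hb, hc] at hinf
  rw [hb] at hcb'
  rw [hc] at htri hcc
  obtain ⟨ha_bar, hc_bar, hpow⟩ := bar_eq_of_commute hcb' hinf htri hcc
  have hφ := degreeMod_of lift_rels1
  have hone {t : G1} (ht : t ∈ S1) : degreeMod rels1 lift_rels1 t = 1 :=
    IsPerturbation.map_eq_one _ ((hφ 2).trans (hφ 0).symm) ((hφ 3).trans (hφ 0).symm) ht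
  refine nonempty_quotient_mulEquiv_zmod _ (degreeMod rels1 lift_rels1)
    (normalClosure_pair_le_ker _ (hone hr) (hone hs)) 0 (hφ 0) ?_ hpow
  intro i
  fin_cases i
  exacts [rfl, ha_bar, hb, hc, hc_bar]

theorem nonempty_G2_quotient {r s : G2} (hr : r ∈ S2) (hs : s ∈ S2) (hrs : r ≠ s) :
    Nonempty ((G2 ⧸ Subgroup.normalClosure {r, s}) ≃* Multiplicative (ZMod 6)) := by
  let π := QuotientGroup.mk' (Subgroup.normalClosure {r, s})
  obtain ⟨hπr, hπs⟩ := map_normalClosure_pair_eq_one r s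
  obtain ⟨hab, hcb, hinf, h₁, h₂, -⟩ := rels2_hom π
  obtain ⟨hb, hc⟩ := eq_and_eq_of_isPerturbation π hr hs hrs hπr hπs hab hcb
  rw [hb, hc] at hinf
  rw [hc] at h₁ h₂
  obtain ⟨ha_bar, hc_bar, hpow⟩ := bar_eq_of_triple hinf h₁ h₂
  have hφ := degreeMod_of lift_rels2
  have hone {t : G2} (ht : t ∈ S2) : degreeMod rels2 lift_rels2 t = 1 :=
    IsPerturbation.map_eq_one _ ((hφ 2).trans (hφ 0).symm) ((hφ 3).trans (hφ 0).symm) ht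
  refine nonempty_quotient_mulEquiv_zmod _ (degreeMod rels2 lift_rels2)
    (normalClosure_pair_le_ker _ (hone hr) (hone hs)) 0 (hφ 0) ?_ hpow
  intro i
  fin_cases i
  exacts [rfl, ha_bar, hb, hc, hc_bar]

/-- Corollary `2.points` of the paper: for each `m ∈ {0,1,2}` and any two *distinct*
relations `R₁, R₂` from the set `{αβ⁻¹, γβ⁻¹, αγ⁻¹, [αβα⁻¹, γ]}`, the quotient of `G_m`
by the normal closure of `{R₁, R₂}` is isomorphic to the cyclic group `ℤ/6`. -/
theorem two_relations_abelian :
    (∀ R₁ ∈ S0, ∀ R₂ ∈ S0, R₁ ≠ R₂ →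
      Nonempty ((G0 ⧸ Subgroup.normalClosure {R₁, R₂}) ≃* Multiplicative (ZMod 6))) ∧
    (∀ R₁ ∈ S1, ∀ R₂ ∈ S1, R₁ ≠ R₂ →
      Nonempty ((G1 ⧸ Subgroup.normalClosure {R₁, R₂}) ≃* Multiplicative (ZMod 6))) ∧
    (∀ R₁ ∈ S2, ∀ R₂ ∈ S2, R₁ ≠ R₂ →
      Nonempty ((G2 ⧸ Subgroup.normalClosure {R₁, R₂}) ≃* Multiplicative (ZMod 6))) := by
  exact ⟨fun _ hr _ hs => nonempty_G0_quotient hr hs, fun _ hr _ hs => nonempty_G1_quotient hr hs,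
    fun _ hr _ hs => nonempty_G2_quotient hr hs⟩
end

section
/- For the group G̃ with distinguished element β: the automorphism τ of A(G̃, β) satisfies τ² − τ + id = 0, so that A(G̃, β) is a module over Λ = ℤ[t]/(t² − t + 1) with t acting as τ; this Λ-module is free of rank 3, with basis the classes of αβ⁻¹, γβ⁻¹ and γ̄β⁻¹. -/
namespace Sextics

abbrev Gt := PresentedGroup relsT

def at' : Gt := PresentedGroup.of 0
def abt : Gt := PresentedGroup.of 1
def bt : Gt := PresentedGroup.of 2
def ct : Gt := PresentedGroup.of 3
def cbt : Gt := PresentedGroup.of 4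

/-- Conjugation by `g` restricted to the commutator subgroup `G′`. -/
def conjSub {G : Type*} [Group G] (g : G) : ↥(commutator G) →* ↥(commutator G) where
  toFun x := ⟨g * (x : G) * g⁻¹, Subgroup.Normal.conj_mem inferInstance (x : G) x.2 g⟩
  map_one' := by ext; simp
  map_mul' x y := by ext; simp [mul_assoc]

/-- The Alexander module `A(G, g) = G′/G″` of a group `G`, written additively.  (The
distinguished element `g` enters through the automorphism `tau g` below.) -/
abbrev AlexMod (G : Type*) [Group G] := Additive (Abelianization ↥(commutator G))

/-- The automorphism `τ` of `A(G, g)` induced by conjugation by `g`: `τ[x] = [g x g⁻¹]`. -/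
def tau {G : Type*} [Group G] (g : G) : AlexMod G → AlexMod G :=
  fun x => Additive.ofMul (Abelianization.map (conjSub g) (Additive.toMul x))

/-- The class in `A(G, g)` of an element of the derived subgroup. -/
def cls {G : Type*} [Group G] {w : G} (h : w ∈ commutator G) : AlexMod G :=
  Additive.ofMul (Abelianization.of (⟨w, h⟩ : ↥(commutator G)))

/-- The ring `Λ = ℤ[t]/(t² − t + 1)`. -/
abbrev Lam :=
  Polynomial ℤ ⧸ Ideal.span ({Polynomial.X ^ 2 - Polynomial.X + 1} : Set (Polynomial ℤ))

/-- The class `t ∈ Λ`. -/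
noncomputable def tL : Lam := Ideal.Quotient.mk _ Polynomial.X

/-- The scalar multiplication of an explicitly given module structure. -/
def smulOf {R M : Type*} [Semiring R] [AddCommMonoid M] (inst : Module R M)
    (r : R) (m : M) : M :=
  @SMul.smul R M inst.toDistribMulAction.toMulAction.toSMul r m

end Sextics

namespace Sextics

section General

variable {G : Type*} [Group G]

lemma cls_congr {v w : G} (hv : v ∈ commutator G) (hw : w ∈ commutator G) (h : v = w) :
    cls hv = cls hw := by
  subst h; rfl

lemma cls_mul {v w : G} (hv : v ∈ commutator G) (hw : w ∈ commutator G) :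
    cls (mul_mem hv hw) = cls hv + cls hw := rfl

lemma cls_inv {w : G} (hw : w ∈ commutator G) : cls (inv_mem hw) = -cls hw := rfl

lemma conj_mem_commutator (g : G) {w : G} (hw : w ∈ commutator G) :
    g * w * g⁻¹ ∈ commutator G :=
  Subgroup.Normal.conj_mem inferInstance w hw g

lemma tau_cls (g : G) {w : G} (hw : w ∈ commutator G) :
    tau g (cls hw) = cls (conj_mem_commutator g hw) := rfl

lemma exists_cls_eq (x : AlexMod G) : ∃ (w : G) (hw : w ∈ commutator G), cls hw = x := by
  obtain ⟨⟨w, hw⟩, h⟩ := QuotientGroup.mk_surjective (Additive.toMul x)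
  exact ⟨w, hw, h⟩

lemma tau_add (g : G) (x y : AlexMod G) : tau g (x + y) = tau g x + tau g y :=
  congrArg Additive.ofMul (map_mul (Abelianization.map (conjSub g)) x.toMul y.toMul)

lemma tau_one (x : AlexMod G) : tau 1 x = x := by
  obtain ⟨w, hw, rfl⟩ := exists_cls_eq x
  rw [tau_cls]
  exact cls_congr _ _ (by simp)

lemma tau_mul (g h : G) (x : AlexMod G) : tau (g * h) x = tau g (tau h x) := by
  obtain ⟨w, hw, rfl⟩ := exists_cls_eq x
  simp only [tau_cls]
  exact cls_congr _ _ (by group)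

lemma tau_injective (g : G) : Function.Injective (tau g) :=
  Function.LeftInverse.injective (g := tau g⁻¹) fun x => by rw [← tau_mul]; simp [tau_one]

/-- `tau g` as an additive endomorphism. -/
def tauHom (g : G) : AddMonoid.End (AlexMod G) := AddMonoidHom.mk' (tau g) (tau_add g)

lemma tau_sub (g : G) (x y : AlexMod G) : tau g (x - y) = tau g x - tau g y :=
  map_sub (tauHom g) x y

lemma tau_zpow_mem_iff {b : G} {K : AddSubgroup (AlexMod G)}
    (hK : ∀ x, tau b x ∈ K ↔ x ∈ K) (n : ℤ) (x : AlexMod G) : tau (b ^ n) x ∈ K ↔ x ∈ K := by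
  let S : Subgroup G :=
    { carrier := {g | ∀ x, tau g x ∈ K ↔ x ∈ K}
      one_mem' := fun x => by rw [tau_one]
      mul_mem' := fun hg hh x => by rw [tau_mul]; exact (hg _).trans (hh _)
      inv_mem' := fun {g} hg x => by
        rw [← hg (tau g⁻¹ x), ← tau_mul, mul_inv_cancel, tau_one] }
  exact S.zpow_mem (show b ∈ S from hK) n x

/-- The elements of `G` of the form `w b ^ n` with `w ∈ G′` of class in a `tau b`-stable
subgroup `K`. -/
def liftSubgroup (b : G) (K : AddSubgroup (AlexMod G)) (hK : ∀ x, tau b x ∈ K ↔ x ∈ K) :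
    Subgroup G where
  carrier := {g | ∃ (n : ℤ) (w : G) (hw : w ∈ commutator G), cls hw ∈ K ∧ g = w * b ^ n}
  one_mem' := ⟨0, 1, one_mem _, K.zero_mem, by simp⟩
  mul_mem' := by
    rintro _ _ ⟨n, v, hv, hvK, rfl⟩ ⟨m, w, hw, hwK, rfl⟩
    refine ⟨n + m, v * (b ^ n * w * (b ^ n)⁻¹), mul_mem hv (conj_mem_commutator _ hw), ?_,
      by group⟩
    rw [cls_mul hv (conj_mem_commutator _ hw), ← tau_cls _ hw]
    exact add_mem hvK ((tau_zpow_mem_iff hK n _).2 hwK)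
  inv_mem' := by
    rintro _ ⟨n, w, hw, hwK, rfl⟩
    refine ⟨-n, b ^ (-n) * w⁻¹ * (b ^ (-n))⁻¹, conj_mem_commutator _ (inv_mem hw), ?_,
      by group⟩
    rw [← tau_cls _ (inv_mem hw), cls_inv hw]
    exact (tau_zpow_mem_iff hK _ _).2 (neg_mem hwK)

lemma mem_liftSubgroup {b g : G} {K : AddSubgroup (AlexMod G)}
    (hK : ∀ x, tau b x ∈ K ↔ x ∈ K) (h : g * b⁻¹ ∈ commutator G) (hg : cls h ∈ K) :
    g ∈ liftSubgroup b K hK :=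
  ⟨1, _, h, hg, by group⟩

lemma mul_inv_mem_commutator_of_braid {x y : G} (h : x * y * x = y * x * y) :
    x * y⁻¹ ∈ commutator G := by
  have hy : y = x * y * x * (x * y)⁻¹ := by rw [h]; group
  have hxy : x * y⁻¹ = x * (x * y) * x⁻¹ * (x * y)⁻¹ := by
    nth_rewrite 1 [hy]
    group
  rw [hxy]
  exact Subgroup.commutator_mem_commutator (Subgroup.mem_top _) (Subgroup.mem_top _)

lemma tau_tau_cls_of_braid {x y : G} (h : x * y * x = y * x * y)
    (hm : x * y⁻¹ ∈ commutator G) :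
    tau y (tau y (cls hm)) - tau y (cls hm) + cls hm = 0 := by
  have key : cls hm + tau y (tau y (cls hm)) = tau y (cls hm) := by
    simp only [tau_cls, ← cls_mul]
    refine cls_congr _ _ ?_
    calc x * y⁻¹ * (y * (y * (x * y⁻¹) * y⁻¹) * y⁻¹) = x * y * x * y⁻¹ * y⁻¹ * y⁻¹ := by group
      _ = _ := by rw [h]; group
  rw [sub_add_eq_add_sub, add_comm, key, sub_self]

end General

section Relations

lemma at_braid : at' * bt * at' = bt * at' * bt := by
  have := PresentedGroup.one_of_mem (rels := relsT) (x := fa * fb * fa * (fb * fa * fb)⁻¹)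
    (by simp [relsT])
  exact mul_inv_eq_one.1 this

lemma abt_braid : abt * bt * abt = bt * abt * bt := by
  have := PresentedGroup.one_of_mem (rels := relsT) (x := fa' * fb * fa' * (fb * fa' * fb)⁻¹)
    (by simp [relsT])
  exact mul_inv_eq_one.1 this

lemma ct_braid : ct * bt * ct = bt * ct * bt := by
  have := PresentedGroup.one_of_mem (rels := relsT) (x := fc * fb * fc * (fb * fc * fb)⁻¹)
    (by simp [relsT])
  exact mul_inv_eq_one.1 this

lemma cbt_braid : cbt * bt * cbt = bt * cbt * bt := by
  have := PresentedGroup.one_of_mem (rels := relsT) (x := fc' * fb * fc' * (fb * fc' * fb)⁻¹)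
    (by simp [relsT])
  exact mul_inv_eq_one.1 this

lemma relation_at_infinity : bt * ct * at' * bt * cbt * abt = 1 :=
  PresentedGroup.one_of_mem (rels := relsT) (x := fb * fc * fa * fb * fc' * fa')
    (by simp [relsT])

lemma at_mem : at' * bt⁻¹ ∈ commutator Gt := mul_inv_mem_commutator_of_braid at_braid
lemma abt_mem : abt * bt⁻¹ ∈ commutator Gt := mul_inv_mem_commutator_of_braid abt_braid
lemma ct_mem : ct * bt⁻¹ ∈ commutator Gt := mul_inv_mem_commutator_of_braid ct_braid
lemma cbt_mem : cbt * bt⁻¹ ∈ commutator Gt := mul_inv_mem_commutator_of_braid cbt_braid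

lemma bt_pow_eq : (bt * (ct * bt⁻¹) * bt⁻¹) * (bt * (bt * (at' * bt⁻¹) * bt⁻¹) * bt⁻¹) *
    (bt * (bt * (bt * (bt * (cbt * bt⁻¹) * bt⁻¹) * bt⁻¹) * bt⁻¹) * bt⁻¹) *
    (bt * (bt * (bt * (bt * (bt * (abt * bt⁻¹) * bt⁻¹) * bt⁻¹) * bt⁻¹) * bt⁻¹) * bt⁻¹) =
    (bt ^ 6)⁻¹ := by
  calc _ = (bt * ct * at' * bt * cbt * abt) * (bt ^ 6)⁻¹ := by group
    _ = _ := by rw [relation_at_infinity, one_mul]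

lemma bt_pow_six_mem : bt ^ 6 ∈ commutator Gt := by
  rw [← inv_mem_iff, ← bt_pow_eq]
  have := @conj_mem_commutator Gt _ bt
  exact mul_mem (mul_mem (mul_mem (this ct_mem) (this (this at_mem)))
    (this (this (this (this cbt_mem))))) (this (this (this (this (this abt_mem)))))

lemma cls_relation_at_infinity :
    tau bt (cls ct_mem) + tau bt (tau bt (cls at_mem)) +
      tau bt (tau bt (tau bt (tau bt (cls cbt_mem)))) +
      tau bt (tau bt (tau bt (tau bt (tau bt (cls abt_mem))))) = -cls bt_pow_six_mem := by
  simp only [tau_cls, ← cls_mul, ← cls_inv]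
  exact cls_congr _ _ bt_pow_eq

lemma six_dvd_of_bt_zpow_mem {n : ℤ} (h : bt ^ n ∈ commutator Gt) : (6 : ℤ) ∣ n := by
  let φ : Gt →* Multiplicative (ZMod 6) :=
    PresentedGroup.toGroup (rels := relsT) (f := fun _ => Multiplicative.ofAdd 1) (by
      intro r hr
      simp only [relsT, Set.mem_insert_iff, Set.mem_singleton_iff] at hr
      rcases hr with rfl | rfl | rfl | rfl | rfl <;>
        simp only [fa, fa', fb, fc, fc', map_mul, map_inv, FreeGroup.lift_apply_of] <;> decide)
  have h1 : φ (bt ^ n) = 1 := Abelianization.commutator_subset_ker φ h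
  have h2 : φ bt = Multiplicative.ofAdd 1 := PresentedGroup.toGroup.of _
  rw [map_zpow, h2, ← ofAdd_zsmul, ofAdd_eq_one] at h1
  exact (ZMod.intCast_zmod_eq_zero_iff_dvd n 6).1 (by simpa using h1)

lemma eq_top_of_stable {K : AddSubgroup (AlexMod Gt)} (hK : ∀ x, tau bt x ∈ K ↔ x ∈ K)
    (ha : cls at_mem ∈ K) (ha' : cls abt_mem ∈ K) (hc : cls ct_mem ∈ K)
    (hc' : cls cbt_mem ∈ K) (x : AlexMod Gt) : x ∈ K := by
  have h6 : cls bt_pow_six_mem ∈ K := by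
    rw [← neg_mem_iff, ← cls_relation_at_infinity]
    refine add_mem (add_mem (add_mem ?_ ?_) ?_) ?_ <;> simpa only [hK]
  have hb : bt ∈ liftSubgroup bt K hK := ⟨1, 1, one_mem _, K.zero_mem, by simp⟩
  have htop : liftSubgroup bt K hK = ⊤ := by
    rw [eq_top_iff, ← PresentedGroup.closure_range_of relsT, Subgroup.closure_le]
    rintro _ ⟨i, rfl⟩
    fin_cases i
    · exact mem_liftSubgroup hK at_mem ha
    · exact mem_liftSubgroup hK abt_mem ha'
    · exact hb
    · exact mem_liftSubgroup hK ct_mem hc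
    · exact mem_liftSubgroup hK cbt_mem hc'
  obtain ⟨w, hw, rfl⟩ := exists_cls_eq x
  obtain ⟨n, v, hv, hvK, rfl⟩ : w ∈ liftSubgroup bt K hK := htop ▸ Subgroup.mem_top w
  have hn : bt ^ n ∈ commutator Gt := (Subgroup.mul_mem_cancel_left _ hv).1 hw
  obtain ⟨k, rfl⟩ := six_dvd_of_bt_zpow_mem hn
  have : cls hn = k • cls bt_pow_six_mem := by
    rw [cls_congr hn (zpow_mem bt_pow_six_mem k) (by rw [zpow_mul]; rfl)]
    rfl
  rw [show cls hw = cls hv + cls hn from cls_mul hv hn, this]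
  exact add_mem hvK (K.zsmul_mem h6 k)

lemma tau_bt_quadratic (x : AlexMod Gt) : tau bt (tau bt x) - tau bt x + x = 0 := by
  let q : AddMonoid.End (AlexMod Gt) := tauHom bt * tauHom bt - tauHom bt + 1
  have hq : ∀ y, q y = tau bt (tau bt y) - tau bt y + y := fun _ => rfl
  have hqt : ∀ y, q (tau bt y) = tau bt (q y) := fun y => by
    simp only [hq, tau_add, tau_sub]
  have hz : tau bt (0 : AlexMod Gt) = 0 := map_zero (tauHom bt)
  refine (hq x).symm.trans (AddMonoidHom.mem_ker.1 (eq_top_of_stable (K := AddMonoidHom.ker q)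
    (fun y => ?_) ?_ ?_ ?_ ?_ x))
  · change q (tau bt y) = 0 ↔ q y = 0
    rw [hqt]
    exact ⟨fun h => tau_injective bt (h.trans hz.symm), fun h => by rw [h, hz]⟩
  · exact tau_tau_cls_of_braid at_braid _
  · exact tau_tau_cls_of_braid abt_braid _
  · exact tau_tau_cls_of_braid ct_braid _
  · exact tau_tau_cls_of_braid cbt_braid _

lemma cls_bt_pow_six : cls bt_pow_six_mem = 0 := by
  have h : tau bt (cls bt_pow_six_mem) = cls bt_pow_six_mem := cls_congr _ _ (by group)
  simpa [h] using tau_bt_quadratic (cls bt_pow_six_mem)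

end Relations

section Lam

lemma tL_quadratic : tL ^ 2 - tL + 1 = 0 :=
  Ideal.Quotient.eq_zero_iff_mem.2 (Ideal.subset_span rfl)

/-- The class of `t` as a unit of `Λ`. -/
noncomputable def tU : Lamˣ where
  val := tL
  inv := 1 - tL
  val_inv := by linear_combination -tL_quadratic
  inv_val := by linear_combination -tL_quadratic

lemma lam_induction {P : Lam → Prop} (hint : ∀ n : ℤ, P n) (hadd : ∀ r s, P r → P s → P (r + s))
    (hmul : ∀ r, P r → P (tL * r)) (r : Lam) : P r := by
  obtain ⟨p, rfl⟩ := Ideal.Quotient.mk_surjective r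
  induction p using Polynomial.induction_on with
  | C n => simpa using hint n
  | add p q hp hq => rw [map_add]; exact hadd _ _ hp hq
  | monomial k n h =>
    convert hmul _ h using 1
    rw [tL, ← map_mul]
    congr 1
    ring

/-- The ring homomorphism `Λ → End A(G̃, β)` sending `t` to `τ`. -/
noncomputable def lamToEnd : Lam →+* AddMonoid.End (AlexMod Gt) :=
  Ideal.Quotient.lift _ (Polynomial.aeval (R := ℤ) (tauHom bt)).toRingHom (by
    intro p hp
    obtain ⟨q, rfl⟩ := Ideal.mem_span_singleton.1 hp
    have : tauHom bt ^ 2 - tauHom bt + 1 = 0 := by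
      ext x
      exact tau_bt_quadratic x
    simp [this])

noncomputable instance alexModule : Module Lam (AlexMod Gt) := Module.compHom _ lamToEnd

lemma tL_smul (x : AlexMod Gt) : tL • x = tau bt x := by
  have : lamToEnd tL = tauHom bt := by simp [lamToEnd, tL]
  exact DFunLike.congr_fun this x

end Lam

section Representation

/-- The action of `Λˣ` on `Λ³`, written multiplicatively. -/
noncomputable def unitsAction : Lamˣ →* MulAut (Multiplicative (Fin 3 → Lam)) where
  toFun u := AddEquiv.toMultiplicative (DistribMulAction.toAddEquiv (Fin 3 → Lam) u)
  map_one' := MulEquiv.ext fun m => one_smul Lamˣ m.toAdd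
  map_mul' u v := MulEquiv.ext fun m => mul_smul u v m.toAdd

/-- The affine group `Λ³ ⋊ Λˣ`. -/
abbrev AffLam := Multiplicative (Fin 3 → Lam) ⋊[unitsAction] Lamˣ

/-- The affine map `x ↦ t x + m` of `Λ³`. -/
noncomputable def affT (m : Fin 3 → Lam) : AffLam := ⟨Multiplicative.ofAdd m, tU⟩

lemma toAdd_left_mul (x y : AffLam) :
    (x * y).left.toAdd = x.left.toAdd + (x.right : Lam) • y.left.toAdd := rfl

lemma aff_ext {x y : AffLam} (hl : ∀ i, x.left.toAdd i = y.left.toAdd i)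
    (hr : (x.right : Lam) = y.right) : x = y :=
  SemidirectProduct.ext (Multiplicative.toAdd.injective (funext hl)) (Units.ext hr)

lemma affT_left (m : Fin 3 → Lam) : (affT m).left.toAdd = m := rfl

lemma affT_right (m : Fin 3 → Lam) : ((affT m).right : Lam) = tL := rfl

lemma affT_braid (m n : Fin 3 → Lam) :
    affT m * affT n * affT m = affT n * affT m * affT n := by
  refine aff_ext (fun i => ?_) ?_
  · simp only [toAdd_left_mul, SemidirectProduct.mul_right, Units.val_mul, affT_left, affT_right,
      Pi.add_apply, Pi.smul_apply, smul_eq_mul]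
    linear_combination (m i - n i) * tL_quadratic
  · simp only [SemidirectProduct.mul_right, Units.val_mul, affT_right]

/-- The translation parts of the images of the generators. -/
noncomputable def genVec : Fin 5 → Fin 3 → Lam :=
  ![Pi.single 0 1, Pi.single 0 1 + (1 - tL) • (Pi.single 1 1 - Pi.single 2 1), 0,
    Pi.single 1 1, Pi.single 2 1]

lemma affT_relation_at_infinity :
    affT (genVec 2) * affT (genVec 3) * affT (genVec 0) * affT (genVec 2) * affT (genVec 4) *
      affT (genVec 1) = 1 := by
  refine aff_ext (fun i => ?_) ?_
  · simp only [toAdd_left_mul, SemidirectProduct.mul_right, Units.val_mul, affT_left, affT_right,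
      Pi.add_apply, Pi.smul_apply, smul_eq_mul, SemidirectProduct.one_left, toAdd_one,
      Pi.zero_apply, genVec, Matrix.cons_val, Pi.sub_apply]
    generalize (Pi.single 0 1 : Fin 3 → Lam) i = a
    generalize (Pi.single 1 1 : Fin 3 → Lam) i = c
    generalize (Pi.single 2 1 : Fin 3 → Lam) i = d
    linear_combination (a * (tL ^ 2 + tL ^ 3) + c * (tL + tL ^ 2 - tL ^ 4) + d * tL ^ 4) *
       tL_quadratic
  · simp only [SemidirectProduct.mul_right, Units.val_mul, affT_right, SemidirectProduct.one_right,
      Units.val_one]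
    linear_combination (tL ^ 4 + tL ^ 3 - tL - 1) * tL_quadratic

/-- The homomorphism `G̃ → Λ³ ⋊ Λˣ`. -/
noncomputable def affRep : Gt →* AffLam :=
  PresentedGroup.toGroup (rels := relsT) (f := fun i => affT (genVec i)) (by
    intro r hr
    simp only [relsT, Set.mem_insert_iff, Set.mem_singleton_iff] at hr
    rcases hr with rfl | rfl | rfl | rfl | rfl <;>
      simp only [fa, fa', fb, fc, fc', map_mul, map_inv, FreeGroup.lift_apply_of]
    · exact mul_inv_eq_one.2 (affT_braid _ _)
    · exact mul_inv_eq_one.2 (affT_braid _ _)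
    · exact mul_inv_eq_one.2 (affT_braid _ _)
    · exact mul_inv_eq_one.2 (affT_braid _ _)
    · exact affT_relation_at_infinity)

lemma affRep_of (i : Fin 5) : affRep (PresentedGroup.of i) = affT (genVec i) :=
  PresentedGroup.toGroup.of _

lemma affRep_right {w : Gt} (hw : w ∈ commutator Gt) : (affRep w).right = 1 :=
  MonoidHom.mem_ker.1 (Abelianization.commutator_subset_ker (A := Lamˣ)
    ((SemidirectProduct.rightHom (φ := unitsAction)).comp affRep) hw)

/-- The translation part of `affRep` on `A(G̃, β)`. -/
noncomputable def transHom : AlexMod Gt →+ (Fin 3 → Lam) :=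
  MonoidHom.toAdditiveLeft <| Abelianization.lift
    { toFun := fun w => (affRep w).left
      map_one' := by simp
      map_mul' := fun v w => by simp [affRep_right v.2] }

lemma transHom_cls {w : Gt} (hw : w ∈ commutator Gt) :
    transHom (cls hw) = (affRep w).left.toAdd := rfl

lemma transHom_tau (x : AlexMod Gt) : transHom (tau bt x) = tL • transHom x := by
  obtain ⟨w, hw, rfl⟩ := exists_cls_eq x
  have hb : affRep bt = affT 0 := affRep_of 2
  rw [tau_cls, transHom_cls, transHom_cls, map_mul, map_mul, map_inv, hb]
  have h : affT 0 * affRep w * (affT 0)⁻¹ =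
      ⟨Multiplicative.ofAdd (tL • (affRep w).left.toAdd), 1⟩ := by
    rw [mul_inv_eq_iff_eq_mul]
    refine aff_ext (fun i => ?_) ?_
    · rw [toAdd_left_mul, toAdd_left_mul]
      simp [affT_left, affT_right]
    · simp [affRep_right hw]
  rw [h]
  rfl

/-- `transHom` as a `Λ`-linear map. -/
noncomputable def transLin : AlexMod Gt →ₗ[Lam] (Fin 3 → Lam) where
  toFun := transHom
  map_add' := map_add transHom
  map_smul' r := by
    refine lam_induction (P := fun r => ∀ x, transHom (r • x) = r • transHom x) (fun n x => ?_)
      (fun r s hr hs x => ?_) (fun r hr x => ?_) r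
    · rw [Int.cast_smul_eq_zsmul, Int.cast_smul_eq_zsmul, map_zsmul]
    · rw [add_smul, add_smul, map_add, hr, hs]
    · rw [mul_smul, tL_smul, transHom_tau, hr]
      exact (mul_smul tL r (transHom x)).symm

lemma transLin_cls_of (i : Fin 5) (h : PresentedGroup.of i * bt⁻¹ ∈ commutator Gt) :
    transLin (cls h) = genVec i := by
  change (affRep (PresentedGroup.of i * bt⁻¹)).left.toAdd = _
  have hb : affRep bt = affT 0 := affRep_of 2
  have : affRep (PresentedGroup.of i * bt⁻¹) = ⟨Multiplicative.ofAdd (genVec i), 1⟩ := by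
    rw [map_mul, map_inv, hb, affRep_of, mul_inv_eq_iff_eq_mul]
    refine aff_ext (fun j => ?_) ?_
    · simp [affT_left]
    · simp [affT_right]
  rw [this]
  rfl

end Representation

section Basis

/-- The classes of `αβ⁻¹`, `γβ⁻¹` and `γ̄β⁻¹`. -/
def basisCls : Fin 3 → AlexMod Gt := ![cls at_mem, cls ct_mem, cls cbt_mem]

lemma cls_abt : cls abt_mem = cls at_mem + (1 - tL) • (cls ct_mem - cls cbt_mem) := by
  have h := cls_relation_at_infinity
  simp only [cls_bt_pow_six, ← tL_smul, smul_smul, neg_zero] at h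
  linear_combination (norm := module) tL • h -
    ((tL ^ 4 + tL ^ 3 - tL - 1) * tL_quadratic) • cls abt_mem -
    ((tL + 1) * tL_quadratic) • cls at_mem - tL_quadratic • cls ct_mem -
    ((tL ^ 3 + tL ^ 2 - 1) * tL_quadratic) • cls cbt_mem

lemma transLin_linearCombination (v : Fin 3 → Lam) :
    transLin (Fintype.linearCombination Lam basisCls v) = v := by
  have h0 : transLin (cls at_mem) = Pi.single 0 1 := transLin_cls_of 0 at_mem
  have h1 : transLin (cls ct_mem) = Pi.single 1 1 := transLin_cls_of 3 ct_mem
  have h2 : transLin (cls cbt_mem) = Pi.single 2 1 := transLin_cls_of 4 cbt_mem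
  ext i
  simp only [Fintype.linearCombination_apply, Fin.sum_univ_three, basisCls, Matrix.cons_val,
    map_add, map_smul, h0, h1, h2]
  fin_cases i <;> simp

lemma linearCombination_surjective :
    Function.Surjective (Fintype.linearCombination Lam basisCls) := by
  let S := LinearMap.range (Fintype.linearCombination Lam basisCls)
  have hb (i : Fin 3) : basisCls i ∈ S := ⟨Pi.single i 1, by simp⟩
  intro x
  refine eq_top_of_stable (K := S.toAddSubgroup) (fun y => ?_) (hb 0) ?_ (hb 1) (hb 2) x
  · rw [← tL_smul]
    exact S.smul_mem_iff_of_isUnit tU.isUnit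
  · rw [cls_abt]
    exact S.add_mem (hb 0) (S.smul_mem _ (S.sub_mem (hb 1) (hb 2)))

end Basis

end Sextics

open Sextics

/-- The Alexander module of the "universal" group `G̃`, with distinguished element `β`:
the automorphism `τ` satisfies `τ² − τ + id = 0`, making `A(G̃, β)` a module over
`Λ = ℤ[t]/(t² − t + 1)` with `t` acting as `τ`, and this module is free of rank `3` with
basis the classes of `αβ⁻¹`, `γβ⁻¹` and `γ̄β⁻¹`. -/
theorem alexander_module_Gt :
    (∀ x : AlexMod Gt, tau bt (tau bt x) - tau bt x + x = 0) ∧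
    ∃ (h1 : at' * bt⁻¹ ∈ commutator Gt) (h2 : ct * bt⁻¹ ∈ commutator Gt)
      (h3 : cbt * bt⁻¹ ∈ commutator Gt) (inst : Module Lam (AlexMod Gt)),
      (∀ x : AlexMod Gt, smulOf inst tL x = tau bt x) ∧
      Function.Bijective (fun v : Fin 3 → Lam =>
        smulOf inst (v 0) (cls h1) + smulOf inst (v 1) (cls h2) +
          smulOf inst (v 2) (cls h3)) := by
  refine ⟨tau_bt_quadratic, at_mem, ct_mem, cbt_mem, alexModule, tL_smul, ?_⟩
  have h : (fun v : Fin 3 → Lam => smulOf alexModule (v 0) (cls at_mem) +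
      smulOf alexModule (v 1) (cls ct_mem) + smulOf alexModule (v 2) (cls cbt_mem)) =
      Fintype.linearCombination Lam basisCls := by
    ext v
    rw [Fintype.linearCombination_apply, Fin.sum_univ_three]
    rfl
  rw [h]
  exact ⟨Function.LeftInverse.injective transLin_linearCombination, linearCombination_surjective⟩
end
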